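/- arXiv:1902.03215 — 3 statements merged into one kernel-verified Lean document; each statement's English description precedes it below -/
import Mathlib

section
/- Let (X,μ) be a σ-finite Lebesgue space with μ(X)=∞ and let T be an invertible measure-preserving transformation of X of rank one. If ν is an ergodic self-joining of T (ergodic meaning every (T×T)-invariant measurable subset of X×X is ν-null or has ν-null complement), then there exist a sequence of integers k(j) and a measure ν′ on X×X such that for all measurable sets A,B ⊆ X of finite measure, μ(A ∩ T^{-k(j)}B) → (1/2)·ν(A×B) + ν′(A×B) as j→∞. -/
open MeasureTheory Filter Topology Set
open scoped ENNReal symmDiff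

/-- `T` has rank one with respect to `μ`: there are towers
`E_j, TE_j, …, T^{h_j}E_j` of pairwise disjoint levels such that every set of
finite measure is approximated arbitrarily well (for all large `j`) by unions
of levels. -/
def IsRankOne {X : Type*} [MeasurableSpace X] (μ : Measure X) (T : Equiv.Perm X) : Prop :=
  ∃ (E : ℕ → Set X) (h : ℕ → ℕ),
    (∀ j, MeasurableSet (E j)) ∧
    (∀ j, ∀ i i' : ℕ, i ≤ h j → i' ≤ h j → i ≠ i' →
      Disjoint ((⇑(T ^ (i : ℤ))) '' E j) ((⇑(T ^ (i' : ℤ))) '' E j)) ∧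
    (∀ A : Set X, MeasurableSet A → μ A < ∞ → ∀ ε : ℝ≥0∞, 0 < ε →
      ∀ᶠ j in atTop, ∃ I : Finset ℕ, (∀ i ∈ I, i ≤ h j) ∧
        μ (symmDiff A (⋃ i ∈ I, (⇑(T ^ (i : ℤ))) '' E j)) < ε)

/-- `ν` is a self-joining of `T`: a `T×T`-invariant measure on `X × X` whose
marginals are both `μ`. -/
def IsSelfJoining {X : Type*} [MeasurableSpace X] (μ : Measure X) (T : Equiv.Perm X)
    (ν : Measure (X × X)) : Prop :=
  Measure.map (Prod.map ⇑T ⇑T) ν = ν ∧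
  ∀ A : Set X, MeasurableSet A → μ A < ∞ →
    ν (A ×ˢ (Set.univ : Set X)) = μ A ∧ ν ((Set.univ : Set X) ×ˢ A) = μ A

theorem exists_measure_of_additive_of_le {Ω : Type*} [MeasurableSpace Ω] (ρ : Measure Ω)
    [IsFiniteMeasure ρ] (f : Set Ω → ℝ≥0∞)
    (hadd : ∀ A B, MeasurableSet A → MeasurableSet B → Disjoint A B → f (A ∪ B) = f A + f B)
    (hle : ∀ A, MeasurableSet A → f A ≤ ρ A) :
    ∃ m : Measure Ω, ∀ A, MeasurableSet A → m A = f A := by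
  have h0 : f ∅ = 0 := by simpa using hle ∅ MeasurableSet.empty
  refine ⟨Measure.ofMeasurable (fun A _ => f A) h0 ?_, fun A hA => Measure.ofMeasurable_apply A hA⟩
  intro s hs hd
  have hfin : ∀ n, f (⋃ i, s i) = ∑ i ∈ Finset.range n, f (s i) + f (⋃ i, s (i + n)) := by
    intro n
    induction n with
    | zero => simp
    | succ n ih =>
      rw [ih, Finset.sum_range_succ, add_assoc, ← hadd _ _ (hs n) (.iUnion fun i => hs _)]
      · congr 2
        ext x
        simp only [mem_iUnion, mem_union]
        constructor
        · rintro ⟨i, hi⟩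
          rcases i with _ | i
          · left; simpa using hi
          · right; exact ⟨i, by rwa [show i + (n + 1) = i + 1 + n by ring]⟩
        · rintro (h | ⟨i, hi⟩)
          · exact ⟨0, by simpa using h⟩
          · exact ⟨i + 1, by rwa [show i + 1 + n = i + (n + 1) by ring]⟩
      · rw [disjoint_iUnion_right]
        exact fun i => hd (by omega)
  have htail : Tendsto (fun n => f (⋃ i, s (i + n))) atTop (𝓝 0) := by
    have hρ : Tendsto (fun n => ∑' i, ρ (s (i + n))) atTop (𝓝 0) := by
      refine ENNReal.tendsto_sum_nat_add (fun i => ρ (s i)) ?_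
      rw [← measure_iUnion hd hs]
      exact measure_ne_top _ _
    refine tendsto_of_tendsto_of_tendsto_of_le_of_le tendsto_const_nhds hρ (fun _ => zero_le) ?_
    exact fun n => (hle _ (.iUnion fun i => hs _)).trans (measure_iUnion_le _)
  have h1 : Tendsto (fun n => ∑ i ∈ Finset.range n, f (s i) + f (⋃ i, s (i + n))) atTop
      (𝓝 (∑' i, f (s i) + 0)) := ENNReal.summable.hasSum.tendsto_sum_nat.add htail
  rw [add_zero] at h1
  exact tendsto_nhds_unique (tendsto_const_nhds.congr hfin) h1

theorem Ultrafilter.exists_tendsto_ennreal {ι : Type*} (ω : Ultrafilter ι) (u : ι → ℝ≥0∞) :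
    ∃ a, Tendsto u ω (𝓝 a) := by
  obtain ⟨a, -, ha⟩ := isCompact_univ.ultrafilter_le_nhds (ω.map u) (by simp)
  exact ⟨a, ha⟩

theorem exists_measure_ultrafilter_tendsto {Ω ι : Type*} [MeasurableSpace Ω] (ρ : Measure Ω)
    [SigmaFinite ρ] (m : ι → Measure Ω) (hm : ∀ j, m j ≤ ρ) (ω : Ultrafilter ι) :
    ∃ m' ≤ ρ, ∀ C, MeasurableSet C → ρ C ≠ ∞ → Tendsto (fun j => m j C) ω (𝓝 (m' C)) := by
  choose f hf using fun C => ω.exists_tendsto_ennreal (fun j => m j C)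
  have hfle : ∀ C, f C ≤ ρ C := fun C =>
    le_of_tendsto' (hf C) fun j => hm j C
  have hfadd : ∀ A B, MeasurableSet B → Disjoint A B → f (A ∪ B) = f A + f B := by
    intro A B hB hd
    refine tendsto_nhds_unique (hf (A ∪ B)) (((hf A).add (hf B)).congr fun j => ?_)
    rw [measure_union hd hB]
  have key : ∀ C, MeasurableSet C → ρ C ≠ ∞ →
      ∃ N : Measure Ω, ∀ A, MeasurableSet A → N A = f (A ∩ C) := by
    intro C hC hCfin
    have : IsFiniteMeasure (ρ.restrict C) := isFiniteMeasure_restrict.2 hCfin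
    refine exists_measure_of_additive_of_le (ρ.restrict C) (fun A => f (A ∩ C)) ?_ ?_
    · intro A B hA hB hd
      rw [union_inter_distrib_right]
      exact hfadd _ _ (hB.inter hC) (hd.mono inter_subset_left inter_subset_left)
    · intro A hA
      rw [Measure.restrict_apply hA]
      exact hfle _
  set Y := disjointed (spanningSets ρ) with hY
  have hYm : ∀ n, MeasurableSet (Y n) := .disjointed (measurableSet_spanningSets ρ)
  have hYfin : ∀ n, ρ (Y n) ≠ ∞ := fun n =>
    ((measure_mono (disjointed_subset _ _)).trans_lt (measure_spanningSets_lt_top ρ n)).ne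
  have hYd : Pairwise (Function.onFun Disjoint Y) := disjoint_disjointed _
  have hYU : ⋃ n, Y n = univ := by rw [hY, iUnion_disjointed, iUnion_spanningSets]
  choose M hM using fun n => key (Y n) (hYm n) (hYfin n)
  have hsum : ∀ C, MeasurableSet C → ρ C ≠ ∞ → Measure.sum M C = f C := by
    intro C hC hCfin
    obtain ⟨N, hN⟩ := key C hC hCfin
    rw [Measure.sum_apply _ hC]
    have h1 : f C = N univ := by rw [hN _ .univ, univ_inter]
    rw [h1, ← hYU, measure_iUnion hYd hYm]
    exact tsum_congr fun n => by rw [hM n C hC, hN _ (hYm n), inter_comm]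
  refine ⟨Measure.sum M, Measure.le_iff.2 fun C hC => ?_, fun C hC hCfin => ?_⟩
  · by_cases h : ρ C = ∞
    · simp [h]
    · rw [hsum C hC h]; exact hfle C
  · rw [hsum C hC hCfin]; exact hf C

theorem Ergodic.exists_eq_smul_of_le {Ω : Type*} [MeasurableSpace Ω] {ν m : Measure Ω}
    [SigmaFinite ν] (S : Ω ≃ᵐ Ω) (hS : Ergodic S ν) (hm : MeasurePreserving S m m)
    (hle : m ≤ ν) : ∃ c : ℝ≥0∞, m = c • ν := by
  have hac : m ≪ ν := Measure.absolutelyContinuous_of_le hle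
  have : SigmaFinite m := by
    refine ⟨⟨⟨spanningSets ν, fun _ => trivial, fun n => ?_, iUnion_spanningSets ν⟩⟩⟩
    exact (hle _).trans_lt (measure_spanningSets_lt_top ν n)
  set f := m.rnDeriv ν
  have hf : Measurable f := Measure.measurable_rnDeriv _ _
  have hmf : ν.withDensity f = m := Measure.withDensity_rnDeriv_eq _ _ hac
  have h1 : ν.withDensity (f ∘ S) = ν.withDensity f := by
    ext C hC
    have hC' : C = S ⁻¹' (S.symm ⁻¹' C) := by
      rw [← preimage_comp]; simp
    have h2 : ν.withDensity (f ∘ S) C = ∫⁻ y in S.symm ⁻¹' C, f y ∂ν := by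
      rw [withDensity_apply _ hC, hC']
      conv_rhs => rw [← preimage_comp]; simp
      exact hS.toMeasurePreserving.setLIntegral_comp_preimage (S.symm.measurable hC) hf
    rw [h2, ← withDensity_apply _ (S.symm.measurable hC), hmf]
    conv_rhs => rw [hC']
    rw [hm.measure_preimage (S.symm.measurable hC).nullMeasurableSet]
  have h2 : f ∘ S =ᵐ[ν] f := by
    refine (withDensity_eq_iff_of_sigmaFinite (hf.comp S.measurable).aemeasurable
      hf.aemeasurable).1 h1
  obtain ⟨c, hc⟩ := hS.ae_eq_const_of_ae_eq_comp₀ hf.nullMeasurable h2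
  refine ⟨c, ?_⟩
  rw [← hmf, withDensity_congr_ae hc]
  exact withDensity_const c

theorem exists_forall_ge_mem_measurableCylinders_iff {C : Set (ℕ → Bool)}
    (hC : C ∈ measurableCylinders (fun _ : ℕ => Bool)) :
    ∃ n₀ : ℕ, ∀ n ≥ n₀, ∀ x y : ℕ → Bool, (∀ i < n, x i = y i) → (x ∈ C ↔ y ∈ C) := by
  obtain ⟨I, S, -, rfl⟩ := (mem_measurableCylinders C).1 hC
  refine ⟨I.sup id + 1, fun n hn x y hxy => ?_⟩
  have : I.restrict x = I.restrict y := by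
    ext ⟨i, hi⟩
    have : i ≤ I.sup id := Finset.le_sup (f := id) hi
    exact hxy i (by omega)
  simp only [mem_cylinder, this]

theorem exists_measure_prod_of_bimeasure_cantor (ρ : Measure (ℕ → Bool)) [IsFiniteMeasure ρ]
    (f : Set (ℕ → Bool) → Set (ℕ → Bool) → ℝ≥0∞)
    (hl : ∀ A A' B, MeasurableSet A → MeasurableSet A' → MeasurableSet B → Disjoint A A' →
      f (A ∪ A') B = f A B + f A' B)
    (hr : ∀ A B B', MeasurableSet A → MeasurableSet B → MeasurableSet B' → Disjoint B B' →
      f A (B ∪ B') = f A B + f A B')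
    (hfl : ∀ A B, MeasurableSet A → MeasurableSet B → f A B ≤ ρ A)
    (hfr : ∀ A B, MeasurableSet A → MeasurableSet B → f A B ≤ ρ B) :
    ∃ π : Measure ((ℕ → Bool) × (ℕ → Bool)),
      ∀ A B, MeasurableSet A → MeasurableSet B → π (A ×ˢ B) = f A B := by
  have hL : ∀ B, MeasurableSet B →
      ∃ L : Measure (ℕ → Bool), ∀ A, MeasurableSet A → L A = f A B := fun B hB =>
    exists_measure_of_additive_of_le ρ (fun A => f A B)
      (fun A A' hA hA' hd => hl A A' B hA hA' hB hd) (fun A hA => hfl A B hA hB)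
  have hR : ∀ A, MeasurableSet A →
      ∃ R : Measure (ℕ → Bool), ∀ B, MeasurableSet B → R B = f A B := fun A hA =>
    exists_measure_of_additive_of_le ρ (fun B => f A B)
      (fun B B' hB hB' hd => hr A B B' hA hB hB' hd) (fun B hB => hfr A B hA hB)
  choose! L hL using hL
  choose! R hR using hR
  have hLR : ∀ A B, MeasurableSet A → MeasurableSet B → L B A = R A B := fun A B hA hB => by
    rw [hL B hB A hA, hR A hA B hB]
  have hLfin : ∀ B, MeasurableSet B → IsFiniteMeasure (L B) := fun B hB =>
    ⟨by rw [hL B hB _ .univ]; exact (hfl _ _ .univ hB).trans_lt (measure_lt_top _ _)⟩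
  have hRfin : ∀ A, MeasurableSet A → IsFiniteMeasure (R A) := fun A hA =>
    ⟨by rw [hR A hA _ .univ]; exact (hfl _ _ hA .univ).trans_lt (measure_lt_top _ _)⟩
  set M := f univ univ with hM
  have hMtop : M ≠ ∞ := ((hfl _ _ .univ .univ).trans_lt (measure_lt_top _ _)).ne
  have hfM : ∀ A B, MeasurableSet A → MeasurableSet B → f A B ≤ M := by
    intro A B hA hB
    calc f A B = L B A := (hL B hB A hA).symm
      _ ≤ L B univ := measure_mono (subset_univ _)
      _ = R univ B := hLR _ _ .univ hB
      _ ≤ R univ univ := measure_mono (subset_univ _)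
      _ = M := hR _ .univ _ .univ
  rcases eq_or_ne M 0 with hM0 | hM0
  · exact ⟨0, fun A B hA hB => by simpa [hM0, eq_comm] using hfM A B hA hB⟩
  let rr : (n : ℕ) → (ℕ → Bool) → (Fin n → Bool) := fun n x i => x i
  have hrr : ∀ n, Measurable (rr n) := fun n => by fun_prop
  let p : (n : ℕ) → (Fin n → Bool) → (ℕ → Bool) := fun n s i => if h : i < n then s ⟨i, h⟩ else false
  have hrc : ∀ n s, MeasurableSet (rr n ⁻¹' {s}) := fun n s => hrr n (measurableSet_singleton s)
  let π : ℕ → Measure ((ℕ → Bool) × (ℕ → Bool)) := fun n =>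
    ∑ s, ∑ t, f (rr n ⁻¹' {s}) (rr n ⁻¹' {t}) • Measure.dirac (p n s, p n t)
  have hCm : ∀ C ∈ measurableCylinders (fun _ : ℕ => Bool), MeasurableSet C := fun C hC =>
    MeasurableSet.of_mem_measurableCylinders hC
  have hπ : ∀ C ∈ measurableCylinders (fun _ : ℕ => Bool),
      ∀ C' ∈ measurableCylinders (fun _ : ℕ => Bool), ∀ᶠ n in atTop, π n (C ×ˢ C') = f C C' := by
    intro C hC C' hC'
    obtain ⟨n₁, h₁⟩ := exists_forall_ge_mem_measurableCylinders_iff hC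
    obtain ⟨n₂, h₂⟩ := exists_forall_ge_mem_measurableCylinders_iff hC'
    filter_upwards [eventually_ge_atTop n₁, eventually_ge_atTop n₂] with n hn₁ hn₂
    classical
    have hpre : ∀ D : Set (ℕ → Bool),
        (∀ x y : ℕ → Bool, (∀ i < n, x i = y i) → (x ∈ D ↔ y ∈ D)) →
        D = rr n ⁻¹' (↑(Finset.univ.filter fun s => p n s ∈ D) : Set (Fin n → Bool)) := by
      intro D hD
      ext x
      simp only [Finset.coe_filter, Finset.mem_univ, true_and, mem_preimage, mem_ofPred_eq]
      exact hD _ _ fun i hi => by simp [p, rr, hi]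
    have e1 : f C C' = ∑ s with p n s ∈ C, f (rr n ⁻¹' {s}) C' := by
      rw [← hL C' (hCm _ hC') C (hCm _ hC)]
      conv_lhs => rw [hpre C (h₁ n hn₁)]
      rw [← sum_measure_preimage_singleton _ (fun s _ => hrc n s)]
      exact Finset.sum_congr rfl fun s _ => hL C' (hCm _ hC') _ (hrc n s)
    have e2 : ∀ s, f (rr n ⁻¹' {s}) C' =
        ∑ t with p n t ∈ C', f (rr n ⁻¹' {s}) (rr n ⁻¹' {t}) := by
      intro s
      rw [← hR _ (hrc n s) C' (hCm _ hC')]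
      conv_lhs => rw [hpre C' (h₂ n hn₂)]
      rw [← sum_measure_preimage_singleton _ (fun s _ => hrc n s)]
      exact Finset.sum_congr rfl fun t _ => hR _ (hrc n s) _ (hrc n t)
    rw [e1, Finset.sum_filter]
    simp only [π, Measure.coe_finsetSum, Finset.sum_apply, Measure.smul_apply]
    refine Finset.sum_congr rfl fun s _ => ?_
    rw [e2 s, Finset.sum_filter]
    split_ifs with hs
    · refine Finset.sum_congr rfl fun t _ => ?_
      rw [Measure.dirac_apply' _ ((hCm _ hC).prod (hCm _ hC'))]
      by_cases ht : p n t ∈ C' <;> simp [hs, ht]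
    · refine Finset.sum_eq_zero fun t _ => ?_
      rw [Measure.dirac_apply' _ ((hCm _ hC).prod (hCm _ hC'))]
      simp [hs]
  have huniv : (univ : Set (ℕ → Bool)) ∈ measurableCylinders (fun _ : ℕ => Bool) :=
    univ_mem_measurableCylinders _
  have hprob : ∀ᶠ n in atTop, IsProbabilityMeasure (M⁻¹ • π n) := by
    filter_upwards [hπ _ huniv _ huniv] with n hn
    refine ⟨?_⟩
    rw [univ_prod_univ] at hn
    rw [Measure.smul_apply, hn, smul_eq_mul, ← hM, ENNReal.inv_mul_cancel hM0 hMtop]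
  obtain ⟨N, hN⟩ := eventually_atTop.1 hprob
  let P : ℕ → ProbabilityMeasure ((ℕ → Bool) × (ℕ → Bool)) := fun n =>
    ⟨M⁻¹ • π (n + N), hN _ (by omega)⟩
  obtain ⟨Q, -, hQ⟩ := isCompact_univ.ultrafilter_le_nhds ((hyperfilter ℕ).map P) (by simp)
  have hQ' : Tendsto P (hyperfilter ℕ) (𝓝 Q) := hQ
  have hclopen : ∀ C ∈ measurableCylinders (fun _ : ℕ => Bool), IsClopen C := by
    intro C hC
    obtain ⟨n, hn⟩ := exists_forall_ge_mem_measurableCylinders_iff hC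
    have : C = rr n ⁻¹' (p n ⁻¹' C) := by
      ext x
      exact hn n le_rfl _ _ fun i hi => by simp [p, rr, hi]
    rw [this]
    exact (isClopen_discrete _).preimage (by fun_prop)
  have hQcyl : ∀ C ∈ measurableCylinders (fun _ : ℕ => Bool),
      ∀ C' ∈ measurableCylinders (fun _ : ℕ => Bool),
      (M • (Q : Measure _)) (C ×ˢ C') = f C C' := by
    intro C hC C' hC'
    have hcl : IsClopen (C ×ˢ C') := (hclopen C hC).prod (hclopen C' hC')
    have h1 := ProbabilityMeasure.tendsto_measure_of_null_frontier_of_tendsto' hQ'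
      (E := C ×ˢ C') (by rw [hcl.frontier_eq]; simp)
    have h2 : Tendsto (fun n => (P n : Measure _) (C ×ˢ C')) (hyperfilter ℕ)
        (𝓝 (M⁻¹ * f C C')) := by
      refine tendsto_const_nhds.congr' ?_
      have : ∀ᶠ n in atTop, π (n + N) (C ×ˢ C') = f C C' :=
        (tendsto_add_atTop_nat N).eventually (hπ C hC C' hC')
      filter_upwards [Nat.hyperfilter_le_atTop this] with n hn
      change _ = (M⁻¹ • π (n + N)) (C ×ˢ C')
      rw [Measure.smul_apply, hn, smul_eq_mul]
    rw [Measure.smul_apply, tendsto_nhds_unique h1 h2, smul_eq_mul, ← mul_assoc,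
      ENNReal.mul_inv_cancel hM0 hMtop, one_mul]
  set Q' : Measure ((ℕ → Bool) × (ℕ → Bool)) := M • (Q : Measure _) with hQ'def
  have hQ'fin : IsFiniteMeasure Q' := by
    refine ⟨?_⟩
    rw [← univ_prod_univ, hQcyl _ huniv _ huniv]
    exact hMtop.lt_top
  have hgen := (generateFrom_measurableCylinders (α := fun _ : ℕ => Bool)).symm
  have hpi := isPiSystem_measurableCylinders (α := fun _ : ℕ => Bool)
  have hstep1 : ∀ A, MeasurableSet A → ∀ C' ∈ measurableCylinders (fun _ : ℕ => Bool),
      Q' (A ×ˢ C') = f A C' := by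
    intro A hA C' hC'
    have hC'm := hCm _ hC'
    have happ : ∀ A, MeasurableSet A → (Q'.restrict (univ ×ˢ C')).map Prod.fst A = Q' (A ×ˢ C') := by
      intro A hA
      rw [Measure.map_apply measurable_fst hA, Measure.restrict_apply (measurable_fst hA)]
      congr 1
      ext ⟨x, y⟩
      simp
    have := hLfin C' hC'm
    have heq : (Q'.restrict (univ ×ˢ C')).map Prod.fst = L C' := by
      refine ext_of_generate_finite _ hgen hpi (fun C hC => ?_) ?_
      · rw [happ C (hCm _ hC), hQcyl C hC C' hC', hL C' hC'm C (hCm _ hC)]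
      · rw [happ _ .univ, hQcyl _ huniv C' hC', hL C' hC'm _ .univ]
    rw [← happ A hA, heq, hL C' hC'm A hA]
  refine ⟨Q', fun A B hA hB => ?_⟩
  have happ : ∀ B, MeasurableSet B → (Q'.restrict (A ×ˢ univ)).map Prod.snd B = Q' (A ×ˢ B) := by
    intro B hB
    rw [Measure.map_apply measurable_snd hB, Measure.restrict_apply (measurable_snd hB)]
    congr 1
    ext ⟨x, y⟩
    simp [and_comm]
  have := hRfin A hA
  have heq : (Q'.restrict (A ×ˢ univ)).map Prod.snd = R A := by
    refine ext_of_generate_finite _ hgen hpi (fun C hC => ?_) ?_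
    · rw [happ C (hCm _ hC), hstep1 A hA C hC, hR A hA C (hCm _ hC)]
    · rw [happ _ .univ, hstep1 A hA _ huniv, hR A hA _ .univ]
  rw [← happ B hB, heq, hR A hA B hB]

theorem exists_measure_prod_of_finite_bimeasure {X : Type*} [MeasurableSpace X]
    [StandardBorelSpace X] (ρ : Measure X) [IsFiniteMeasure ρ] (f : Set X → Set X → ℝ≥0∞)
    (hl : ∀ A A' B, MeasurableSet A → MeasurableSet A' → MeasurableSet B → Disjoint A A' →
      f (A ∪ A') B = f A B + f A' B)
    (hr : ∀ A B B', MeasurableSet A → MeasurableSet B → MeasurableSet B' → Disjoint B B' →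
      f A (B ∪ B') = f A B + f A B')
    (hfl : ∀ A B, MeasurableSet A → MeasurableSet B → f A B ≤ ρ A)
    (hfr : ∀ A B, MeasurableSet A → MeasurableSet B → f A B ≤ ρ B) :
    ∃ π : Measure (X × X),
      ∀ A B, MeasurableSet A → MeasurableSet B → π (A ×ˢ B) = f A B := by
  let e := MeasurableSpace.mapNatBool X
  have he : Measurable e := MeasurableSpace.measurable_mapNatBool X
  have hinj : Function.Injective e := MeasurableSpace.injective_mapNatBool X
  have hemb : MeasurableEmbedding e := he.measurableEmbedding hinj
  obtain ⟨π, hπ⟩ := exists_measure_prod_of_bimeasure_cantor (ρ.map e)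
    (fun A B => f (e ⁻¹' A) (e ⁻¹' B))
    (fun A A' B hA hA' hB hd => hl _ _ _ (he hA) (he hA') (he hB) (hd.preimage e))
    (fun A B B' hA hB hB' hd => hr _ _ _ (he hA) (he hB) (he hB') (hd.preimage e))
    (fun A B hA hB => by rw [Measure.map_apply he hA]; exact hfl _ _ (he hA) (he hB))
    (fun A B hA hB => by rw [Measure.map_apply he hB]; exact hfr _ _ (he hA) (he hB))
  have hemb2 : MeasurableEmbedding (Prod.map e e) := hemb.prodMap hemb
  refine ⟨π.comap (Prod.map e e), fun A B hA hB => ?_⟩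
  rw [hemb2.comap_apply, prodMap_image_prod,
    hπ _ _ (hemb.measurableSet_image.2 hA) (hemb.measurableSet_image.2 hB),
    preimage_image_eq _ hinj, preimage_image_eq _ hinj]

theorem exists_measure_prod_of_bimeasure {X : Type*} [MeasurableSpace X]
    [StandardBorelSpace X] (μ : Measure X) [SigmaFinite μ] (f : Set X → Set X → ℝ≥0∞)
    (hl : ∀ A A' B, MeasurableSet A → MeasurableSet A' → MeasurableSet B →
      μ A ≠ ∞ → μ A' ≠ ∞ → μ B ≠ ∞ → Disjoint A A' → f (A ∪ A') B = f A B + f A' B)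
    (hr : ∀ A B B', MeasurableSet A → MeasurableSet B → MeasurableSet B' →
      μ A ≠ ∞ → μ B ≠ ∞ → μ B' ≠ ∞ → Disjoint B B' → f A (B ∪ B') = f A B + f A B')
    (hfl : ∀ A B, MeasurableSet A → MeasurableSet B → μ A ≠ ∞ → μ B ≠ ∞ → f A B ≤ μ A)
    (hfr : ∀ A B, MeasurableSet A → MeasurableSet B → μ A ≠ ∞ → μ B ≠ ∞ → f A B ≤ μ B) :
    ∃ π : Measure (X × X), ∀ A B, MeasurableSet A → MeasurableSet B → μ A ≠ ∞ → μ B ≠ ∞ →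
      π (A ×ˢ B) = f A B := by
  have key : ∀ Y Z : Set X, MeasurableSet Y → MeasurableSet Z → μ Y ≠ ∞ → μ Z ≠ ∞ →
      ∃ π : Measure (X × X),
        ∀ A B, MeasurableSet A → MeasurableSet B → π (A ×ˢ B) = f (A ∩ Y) (B ∩ Z) := by
    intro Y Z hY hZ hYf hZf
    have hYf' : ∀ A, μ (A ∩ Y) ≠ ∞ := fun A => measure_ne_top_of_subset inter_subset_right hYf
    have hZf' : ∀ A, μ (A ∩ Z) ≠ ∞ := fun A => measure_ne_top_of_subset inter_subset_right hZf
    have : IsFiniteMeasure (μ.restrict Y) := isFiniteMeasure_restrict.2 hYf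
    have : IsFiniteMeasure (μ.restrict Z) := isFiniteMeasure_restrict.2 hZf
    refine exists_measure_prod_of_finite_bimeasure (μ.restrict Y + μ.restrict Z)
      (fun A B => f (A ∩ Y) (B ∩ Z)) ?_ ?_ ?_ ?_
    · intro A A' B hA hA' hB hd
      rw [union_inter_distrib_right]
      exact hl _ _ _ (hA.inter hY) (hA'.inter hY) (hB.inter hZ) (hYf' _) (hYf' _) (hZf' _)
        (hd.mono inter_subset_left inter_subset_left)
    · intro A B B' hA hB hB' hd
      rw [union_inter_distrib_right]
      exact hr _ _ _ (hA.inter hY) (hB.inter hZ) (hB'.inter hZ) (hYf' _) (hZf' _) (hZf' _)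
        (hd.mono inter_subset_left inter_subset_left)
    · intro A B hA hB
      refine (hfl _ _ (hA.inter hY) (hB.inter hZ) (hYf' _) (hZf' _)).trans ?_
      rw [← Measure.restrict_apply hA]
      exact Measure.le_add_right le_rfl _
    · intro A B hA hB
      refine (hfr _ _ (hA.inter hY) (hB.inter hZ) (hYf' _) (hZf' _)).trans ?_
      rw [← Measure.restrict_apply hB]
      exact Measure.le_add_left le_rfl _
  set Y := disjointed (spanningSets μ) with hYdef
  have hYm : ∀ n, MeasurableSet (Y n) := .disjointed (measurableSet_spanningSets μ)
  have hYfin : ∀ n, μ (Y n) ≠ ∞ := fun n =>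
    ((measure_mono (disjointed_subset _ _)).trans_lt (measure_spanningSets_lt_top μ n)).ne
  have hYd : Pairwise (Function.onFun Disjoint Y) := disjoint_disjointed _
  have hYU : ⋃ n, Y n = univ := by rw [hYdef, iUnion_disjointed, iUnion_spanningSets]
  choose M hM using fun q : ℕ × ℕ =>
    key (Y q.1) (Y q.2) (hYm _) (hYm _) (hYfin _) (hYfin _)
  refine ⟨Measure.sum M, fun A B hA hB hAf hBf => ?_⟩
  obtain ⟨N, hN⟩ := key A B hA hB hAf hBf
  have h1 : f A B = N univ := by
    rw [← univ_prod_univ, hN _ _ .univ .univ, univ_inter, univ_inter]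
  have h2 : (univ : Set (X × X)) = ⋃ q : ℕ × ℕ, Y q.1 ×ˢ Y q.2 := by
    rw [← univ_prod_univ, ← hYU, iUnion_prod]
  rw [Measure.sum_apply _ (hA.prod hB), h1, h2, measure_iUnion _ fun q => (hYm _).prod (hYm _)]
  · exact tsum_congr fun q => by
      rw [hM q A B hA hB, hN _ _ (hYm _) (hYm _), inter_comm, inter_comm B]
  · rintro ⟨a, b⟩ ⟨c, d⟩ hne
    rw [Function.onFun, Set.disjoint_prod]
    by_cases hac : a = c
    · right; exact hYd fun h => hne (by simp only at h; rw [hac, h])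
    · left; exact hYd hac

section Basics
variable {X : Type*} [MeasurableSpace X]

theorem Equiv.Perm.measurePreserving_zpow {μ : Measure X} {T : Equiv.Perm X}
    (hT : MeasurePreserving T μ μ) (hT' : Measurable T.symm) (k : ℤ) :
    MeasurePreserving ⇑(T ^ k) μ μ := by
  have hTi : MeasurePreserving ⇑(T⁻¹) μ μ := hT.symm (⟨T, hT.measurable, hT'⟩ : X ≃ᵐ X)
  have hpow : ∀ {S : Equiv.Perm X}, MeasurePreserving S μ μ →
      ∀ n : ℕ, MeasurePreserving ⇑(S ^ n) μ μ := by
    intro S hS n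
    rw [Equiv.Perm.coe_pow]
    exact hS.iterate n
  rcases Int.eq_nat_or_neg k with ⟨n, rfl | rfl⟩
  · rw [zpow_natCast]; exact hpow hT n
  · rw [zpow_neg, zpow_natCast, ← inv_pow]; exact hpow hTi n

omit [MeasurableSpace X] in
theorem Equiv.Perm.image_zpow_eq_preimage (T : Equiv.Perm X) (k : ℤ) (E : Set X) :
    ⇑(T ^ k) '' E = ⇑(T ^ (-k)) ⁻¹' E := by
  rw [zpow_neg]
  exact Equiv.image_eq_preimage_symm _ _

omit [MeasurableSpace X] in
theorem Equiv.Perm.image_zpow_image_zpow (T : Equiv.Perm X) (k l : ℤ) (E : Set X) :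
    ⇑(T ^ k) '' (⇑(T ^ l) '' E) = ⇑(T ^ (k + l)) '' E := by
  rw [zpow_add, Equiv.Perm.coe_mul, image_comp]

theorem Equiv.Perm.measurableSet_image_zpow {μ : Measure X} {T : Equiv.Perm X}
    (hT : MeasurePreserving T μ μ) (hT' : Measurable T.symm) (k : ℤ) {E : Set X}
    (hE : MeasurableSet E) : MeasurableSet (⇑(T ^ k) '' E) := by
  rw [T.image_zpow_eq_preimage]
  exact (measurePreserving_zpow hT hT' _).measurable hE

theorem Equiv.Perm.measure_image_zpow {μ : Measure X} {T : Equiv.Perm X}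
    (hT : MeasurePreserving T μ μ) (hT' : Measurable T.symm) (k : ℤ) {E : Set X}
    (hE : MeasurableSet E) : μ (⇑(T ^ k) '' E) = μ E := by
  rw [T.image_zpow_eq_preimage]
  exact (measurePreserving_zpow hT hT' _).measure_preimage hE.nullMeasurableSet

/-- The union of the levels `T ^ i E`, `i ∈ I`, of a tower with base `E`. -/
def towerUnion (T : Equiv.Perm X) (E : Set X) (I : Finset ℕ) : Set X :=
  ⋃ i ∈ I, ⇑(T ^ (i : ℤ)) '' E

omit [MeasurableSpace X] in
theorem mem_towerUnion {T : Equiv.Perm X} {E : Set X} {I : Finset ℕ} {x : X} :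
    x ∈ towerUnion T E I ↔ ∃ i ∈ I, x ∈ ⇑(T ^ (i : ℤ)) '' E := by
  simp only [towerUnion, mem_iUnion, exists_prop]

theorem measurableSet_towerUnion {μ : Measure X} {T : Equiv.Perm X}
    (hT : MeasurePreserving T μ μ) (hT' : Measurable T.symm) {E : Set X}
    (hE : MeasurableSet E) (I : Finset ℕ) : MeasurableSet (towerUnion T E I) :=
  I.measurableSet_biUnion fun _ _ => Equiv.Perm.measurableSet_image_zpow hT hT' _ hE

omit [MeasurableSpace X] in
theorem subset_towerUnion (T : Equiv.Perm X) (E : Set X) {I : Finset ℕ} {i : ℕ} (hi : i ∈ I) :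
    ⇑(T ^ (i : ℤ)) '' E ⊆ towerUnion T E I :=
  fun _ hx => mem_towerUnion.2 ⟨i, hi, hx⟩

/-- Measures on the square whose marginals are at most `μ`. -/
structure IsSubmarginal (μ : Measure X) (D : Measure (X × X)) : Prop where
  left : ∀ A, MeasurableSet A → D (A ×ˢ univ) ≤ μ A
  right : ∀ A, MeasurableSet A → D (univ ×ˢ A) ≤ μ A

theorem IsSubmarginal.restrict {μ : Measure X} {D : Measure (X × X)} (hD : IsSubmarginal μ D)
    (C : Set (X × X)) : IsSubmarginal μ (D.restrict C) :=
  ⟨fun A hA => (Measure.restrict_apply_le C _).trans (hD.left A hA),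
    fun A hA => (Measure.restrict_apply_le C _).trans (hD.right A hA)⟩

theorem IsSubmarginal.le_left {μ : Measure X} {D : Measure (X × X)} (hD : IsSubmarginal μ D)
    {A : Set X} (hA : MeasurableSet A) (B : Set X) : D (A ×ˢ B) ≤ μ A :=
  (measure_mono (prod_mono le_rfl (subset_univ B))).trans (hD.left A hA)

theorem IsSubmarginal.le_right {μ : Measure X} {D : Measure (X × X)} (hD : IsSubmarginal μ D)
    (A : Set X) {B : Set X} (hB : MeasurableSet B) : D (A ×ˢ B) ≤ μ B :=
  (measure_mono (prod_mono (subset_univ A) le_rfl)).trans (hD.right B hB)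

theorem IsSubmarginal.prod_le_add_symmDiff {μ : Measure X} {D : Measure (X × X)}
    (hD : IsSubmarginal μ D) {A A' B B' : Set X} (hA : MeasurableSet A) (hA' : MeasurableSet A')
    (hB : MeasurableSet B) (hB' : MeasurableSet B') :
    D (A ×ˢ B) ≤ D (A' ×ˢ B') + μ (A ∆ A') + μ (B ∆ B') := by
  have hsub : A ×ˢ B ⊆ A' ×ˢ B' ∪ (A ∆ A') ×ˢ univ ∪ univ ×ˢ (B ∆ B') := by
    rintro ⟨x, y⟩ ⟨hx, hy⟩
    simp only [mem_union, mem_prod, mem_univ, and_true, true_and, mem_symmDiff]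
    tauto
  refine (measure_mono hsub).trans ((measure_union_le _ _).trans (add_le_add
    ((measure_union_le _ _).trans (add_le_add le_rfl (hD.left _ ?_))) (hD.right _ ?_)))
  · exact hA.symmDiff hA'
  · exact hB.symmDiff hB'

/-- The measure carried by the graph of `T ^ k`. -/
noncomputable def graphMeasure (μ : Measure X) (T : Equiv.Perm X) (k : ℤ) : Measure (X × X) :=
  μ.map fun x => (x, (T ^ k) x)

theorem graphMeasure_prod {μ : Measure X} {T : Equiv.Perm X}
    (hT : MeasurePreserving T μ μ) (hT' : Measurable T.symm) (k : ℤ) {A B : Set X}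
    (hA : MeasurableSet A) (hB : MeasurableSet B) :
    graphMeasure μ T k (A ×ˢ B) = μ (A ∩ ⇑(T ^ k) ⁻¹' B) := by
  have hm := (Equiv.Perm.measurePreserving_zpow hT hT' k).measurable
  rw [graphMeasure, Measure.map_apply (measurable_id'.prodMk hm) (hA.prod hB)]
  rfl

theorem isSubmarginal_graphMeasure {μ : Measure X} {T : Equiv.Perm X}
    (hT : MeasurePreserving T μ μ) (hT' : Measurable T.symm) (k : ℤ) :
    IsSubmarginal μ (graphMeasure μ T k) := by
  constructor <;> intro A hA
  · rw [graphMeasure_prod hT hT' k hA .univ]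
    exact measure_mono inter_subset_left
  · rw [graphMeasure_prod hT hT' k .univ hA]
    refine (measure_mono inter_subset_right).trans_eq ?_
    exact (Equiv.Perm.measurePreserving_zpow hT hT' k).measure_preimage hA.nullMeasurableSet

theorem IsSelfJoining.isSubmarginal {μ : Measure X} {T : Equiv.Perm X} {ν : Measure (X × X)}
    (hν : IsSelfJoining μ T ν) : IsSubmarginal μ ν := by
  constructor <;> intro A hA <;> rcases eq_or_ne (μ A) ∞ with h | h
  · simp [h]
  · exact (hν.2 A hA h.lt_top).1.le
  · simp [h]
  · exact (hν.2 A hA h.lt_top).2.le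

theorem IsSubmarginal.sigmaFinite {μ : Measure X} [SigmaFinite μ] {D : Measure (X × X)}
    (hD : IsSubmarginal μ D) : SigmaFinite D := by
  refine ⟨⟨⟨fun n => spanningSets μ n ×ˢ univ, fun _ => trivial, fun n => ?_, ?_⟩⟩⟩
  · exact (hD.left _ (measurableSet_spanningSets μ n)).trans_lt (measure_spanningSets_lt_top μ n)
  · rw [← iUnion_prod_const, iUnion_spanningSets, univ_prod_univ]

/-- A sequence of towers witnessing that `T` has rank one. -/
structure IsRankOneTower (μ : Measure X) (T : Equiv.Perm X) (E : ℕ → Set X) (h : ℕ → ℕ) :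
    Prop where
  measurableSet : ∀ j, MeasurableSet (E j)
  disjoint : ∀ j, ∀ i i' : ℕ, i ≤ h j → i' ≤ h j → i ≠ i' →
    Disjoint (⇑(T ^ (i : ℤ)) '' E j) (⇑(T ^ (i' : ℤ)) '' E j)
  approx : ∀ A : Set X, MeasurableSet A → μ A < ∞ → ∀ ε : ℝ≥0∞, 0 < ε →
    ∀ᶠ j in atTop, ∃ I : Finset ℕ, (∀ i ∈ I, i ≤ h j) ∧ μ (A ∆ towerUnion T (E j) I) < ε

namespace IsRankOneTower
variable {μ : Measure X} {T : Equiv.Perm X} {E : ℕ → Set X} {h : ℕ → ℕ}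

theorem disjoint_shift (H : IsRankOneTower μ T E h) (j : ℕ) {a b : ℤ} (hab : a ≠ b)
    (hle : |a - b| ≤ h j) : Disjoint (⇑(T ^ a) '' E j) (⇑(T ^ b) '' E j) := by
  wlog hlt : a < b generalizing a b
  · exact (this hab.symm (by rwa [abs_sub_comm]) (by omega)).symm
  have hd := H.disjoint j 0 (b - a).toNat (Nat.zero_le _)
    (by rw [abs_of_neg (by omega)] at hle; omega) (by omega)
  have := (disjoint_image_iff (T ^ a).injective).2 hd
  rwa [Equiv.Perm.image_zpow_image_zpow, Equiv.Perm.image_zpow_image_zpow, Nat.cast_zero,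
    add_zero, Int.toNat_of_nonneg (by omega), add_sub_cancel] at this

theorem exists_tendsto (H : IsRankOneTower μ T E h) {A : Set X} (hA : MeasurableSet A)
    (hAf : μ A ≠ ∞) : ∃ I : ℕ → Finset ℕ, (∀ j, ∀ i ∈ I j, i ≤ h j) ∧
      Tendsto (fun j => μ (A ∆ towerUnion T (E j) (I j))) atTop (𝓝 0) := by
  have hmin : ∀ j, ∃ I : Finset ℕ, (∀ i ∈ I, i ≤ h j) ∧ ∀ J : Finset ℕ, (∀ i ∈ J, i ≤ h j) →
      μ (A ∆ towerUnion T (E j) I) ≤ μ (A ∆ towerUnion T (E j) J) := by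
    intro j
    obtain ⟨I, hI, hImin⟩ := (Finset.range (h j + 1)).powerset.exists_min_image
      (fun I => μ (A ∆ towerUnion T (E j) I)) ⟨∅, by simp⟩
    refine ⟨I, fun i hi => ?_, fun J hJ => hImin J ?_⟩
    · have := Finset.mem_range.1 (Finset.mem_powerset.1 hI hi)
      omega
    · exact Finset.mem_powerset.2 fun i hi => Finset.mem_range.2 (Nat.lt_succ_of_le (hJ i hi))
  choose I hI hImin using hmin
  refine ⟨I, hI, ENNReal.tendsto_nhds_zero.2 fun ε hε => ?_⟩
  filter_upwards [H.approx A hA hAf.lt_top ε hε] with j ⟨J, hJ, hJlt⟩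
  exact (hImin j J hJ).trans hJlt.le

theorem eventually_base_le (H : IsRankOneTower μ T E h) (hT : MeasurePreserving T μ μ)
    (hT' : Measurable T.symm) {A : Set X} (hA : MeasurableSet A)
    (hAf : μ A ≠ ∞) (hA0 : μ A ≠ 0) : ∀ᶠ j in atTop, μ (E j) ≤ 2 * μ A := by
  filter_upwards [H.approx A hA hAf.lt_top _ hA0.bot_lt] with j ⟨I, hI, hlt⟩
  have hne : I.Nonempty := by
    rw [Finset.nonempty_iff_ne_empty]
    rintro rfl
    simp only [towerUnion, Finset.notMem_empty, iUnion_of_empty, iUnion_empty] at hlt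
    exact hlt.ne (congrArg μ (symmDiff_bot A))
  obtain ⟨i, hi⟩ := hne
  rw [← Equiv.Perm.measure_image_zpow hT hT' i (H.measurableSet j), two_mul]
  calc μ (⇑(T ^ (i : ℤ)) '' E j) ≤ μ (A ∪ A ∆ towerUnion T (E j) I) := by
        refine measure_mono fun x hx => ?_
        have := subset_towerUnion T (E j) hi hx
        simp only [mem_union, mem_symmDiff]
        tauto
    _ ≤ _ := (measure_union_le _ _).trans (add_le_add le_rfl hlt.le)

theorem tendsto_diff_full (H : IsRankOneTower μ T E h) {A : Set X} (hA : MeasurableSet A)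
    (hAf : μ A ≠ ∞) :
    Tendsto (fun j => μ (A \ towerUnion T (E j) (Finset.range (h j + 1)))) atTop (𝓝 0) := by
  obtain ⟨I, hI, hlim⟩ := H.exists_tendsto hA hAf
  refine tendsto_of_tendsto_of_tendsto_of_le_of_le tendsto_const_nhds hlim
    (fun _ => zero_le) fun j => measure_mono ?_
  rintro x ⟨hxA, hxU⟩
  refine Or.inl ⟨hxA, fun hx => hxU ?_⟩
  obtain ⟨i, hi, hxi⟩ := mem_towerUnion.1 hx
  exact mem_towerUnion.2 ⟨i, Finset.mem_range.2 (Nat.lt_succ_of_le (hI j i hi)), hxi⟩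

end IsRankOneTower
end Basics

section Boundary
variable {X : Type*} [MeasurableSpace X] {μ : Measure X} {T : Equiv.Perm X}

theorem Equiv.Perm.image_zpow_ae_le (hT : MeasurePreserving T μ μ) (hT' : Measurable T.symm)
    (k : ℤ) {A B : Set X} (hAB : A ≤ᵐ[μ] B) : ⇑(T ^ k) '' A ≤ᵐ[μ] ⇑(T ^ k) '' B := by
  rw [T.image_zpow_eq_preimage, T.image_zpow_eq_preimage]
  exact (measurePreserving_zpow hT hT' _).quasiMeasurePreserving.preimage_mono_ae hAB

theorem Equiv.Perm.image_zpow_ae_eq (hT : MeasurePreserving T μ μ) (hT' : Measurable T.symm)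
    (k : ℤ) {A B : Set X} (hAB : A =ᵐ[μ] B) : ⇑(T ^ k) '' A =ᵐ[μ] ⇑(T ^ k) '' B :=
  (image_zpow_ae_le hT hT' k hAB.le).antisymm (image_zpow_ae_le hT hT' k hAB.symm.le)

namespace IsRankOneTower
variable {E : ℕ → Set X} {h : ℕ → ℕ}

theorem level_ae_le_of_inter_ne_zero (H : IsRankOneTower μ T E h) {j : ℕ} {B : Set X}
    {I : Finset ℕ} (hI : ∀ i ∈ I, i ≤ h j) (hB : B =ᵐ[μ] towerUnion T (E j) I) {i : ℕ}
    (hi : i ≤ h j) (hne : μ (B ∩ ⇑(T ^ (i : ℤ)) '' E j) ≠ 0) :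
    ⇑(T ^ (i : ℤ)) '' E j ≤ᵐ[μ] B := by
  by_cases hiI : i ∈ I
  · exact (subset_towerUnion T (E j) hiI).eventuallyLE.trans hB.symm.le
  · refine absurd (measure_mono_null ?_ (ae_le_set.1 hB.le)) hne
    rintro x ⟨hxB, hxi⟩
    refine ⟨hxB, fun hx => ?_⟩
    obtain ⟨i', hi', hxi'⟩ := mem_towerUnion.1 hx
    exact disjoint_left.1 (H.disjoint j i i' hi (hI i' hi') fun e => hiI (e ▸ hi')) hxi hxi'

theorem level_ae_le_level (H : IsRankOneTower μ T E h) {j : ℕ} {B : Set X}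
    {I : Finset ℕ} (hI : ∀ i ∈ I, i ≤ h j) (hB : B =ᵐ[μ] towerUnion T (E j) I) {a : ℤ} {b : ℕ}
    (ha : ∀ i : ℕ, i ≤ h j → i ≠ b → a ≠ i ∧ |a - i| ≤ h j)
    (hle : ⇑(T ^ a) '' E j ≤ᵐ[μ] B) : ⇑(T ^ a) '' E j ≤ᵐ[μ] ⇑(T ^ (b : ℤ)) '' E j := by
  refine ae_le_set.2 (measure_mono_null ?_ (ae_le_set.1 (hle.trans hB.le)))
  rintro x ⟨hxa, hxb⟩
  refine ⟨hxa, fun hx => ?_⟩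
  obtain ⟨i, hi, hxi⟩ := mem_towerUnion.1 hx
  rcases eq_or_ne i b with rfl | hib
  · exact hxb hxi
  · obtain ⟨h1, h2⟩ := ha i (hI i hi) hib
    exact disjoint_left.1 (H.disjoint_shift j h1 h2) hxa hxi

theorem eventually_ae_eq_towerUnion (H : IsRankOneTower μ T E h) {c : ℝ≥0∞} (hc0 : 0 < c)
    (hT : MeasurePreserving T μ μ) (hT' : Measurable T.symm)
    (hc : ∀ A, MeasurableSet A → μ A < c → μ A = 0) {A : Set X} (hA : MeasurableSet A)
    (hAf : μ A ≠ ∞) :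
    ∀ᶠ j in atTop, ∃ I : Finset ℕ, (∀ i ∈ I, i ≤ h j) ∧ A =ᵐ[μ] towerUnion T (E j) I := by
  filter_upwards [H.approx A hA hAf.lt_top c hc0] with j ⟨I, hI, hlt⟩
  exact ⟨I, hI, measure_symmDiff_eq_zero_iff.1
    (hc _ (hA.symmDiff (measurableSet_towerUnion hT hT' (H.measurableSet j) I)) hlt)⟩

theorem not_cyclic (H : IsRankOneTower μ T E h) (hinf : μ univ = ∞) [SigmaFinite μ]
    (hT : MeasurePreserving T μ μ) (hT' : Measurable T.symm) {c : ℝ≥0∞} (hc0 : 0 < c)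
    (hc : ∀ A, MeasurableSet A → μ A < c → μ A = 0) {j : ℕ} (hE0 : μ (E j) ≠ 0)
    (hEf : μ (E j) ≠ ∞) : ¬ ⇑(T ^ ((h j : ℤ) + 1)) '' E j ≤ᵐ[μ] E j := by
  intro hcyc
  set U := towerUnion T (E j) (Finset.range (h j + 1)) with hU
  have hUm : MeasurableSet U := measurableSet_towerUnion hT hT' (H.measurableSet j) _
  have hEU : E j ⊆ U := by
    have := subset_towerUnion T (E j) (I := Finset.range (h j + 1)) (i := 0) (by simp)
    simpa using this
  have hU0 : μ U ≠ 0 := fun h0 => hE0 (measure_mono_null hEU h0)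
  have hUf : μ U ≠ ∞ := by
    refine ((measure_biUnion_finset_le _ _).trans_lt (ENNReal.sum_lt_top.2 fun i _ => ?_)).ne
    rw [Equiv.Perm.measure_image_zpow hT hT' _ (H.measurableSet j)]
    exact hEf.lt_top
  have hTU : ⇑(T ^ (1 : ℤ)) '' U ≤ᵐ[μ] U := by
    refine ae_le_set.2 (measure_mono_null ?_ (ae_le_set.1 hcyc))
    rintro _ ⟨⟨x, hx, rfl⟩, hxU⟩
    obtain ⟨i, hi, y, hy, rfl⟩ := mem_towerUnion.1 hx
    rw [← Equiv.Perm.mul_apply, ← zpow_add] at hxU ⊢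
    have hi' := Finset.mem_range.1 hi
    have : i = h j := by
      by_contra hne
      exact hxU (mem_towerUnion.2 ⟨i + 1, Finset.mem_range.2 (by omega), y, hy, by
        push_cast; rw [add_comm]⟩)
    subst this
    exact ⟨⟨y, hy, by rw [add_comm]⟩, fun h => hxU (hEU h)⟩
  have hTU1 : ⇑(T ^ (1 : ℤ)) '' U =ᵐ[μ] U :=
    ae_eq_of_ae_subset_of_measure_ge hTU
      (Equiv.Perm.measure_image_zpow hT hT' 1 hUm).ge
      (Equiv.Perm.measurableSet_image_zpow hT hT' 1 hUm).nullMeasurableSet hUf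
  have hTUn : ∀ n : ℤ, ⇑(T ^ n) '' U =ᵐ[μ] U := by
    intro n
    induction n using Int.induction_on with
    | zero =>
      rw [zpow_zero, Equiv.Perm.coe_one, image_id]
      exact EventuallyEq.rfl
    | succ n ih =>
      rw [add_comm, ← Equiv.Perm.image_zpow_image_zpow]
      exact (Equiv.Perm.image_zpow_ae_eq hT hT' 1 ih).trans hTU1
    | pred n ih =>
      have h1 : ⇑(T ^ (-1 : ℤ)) '' U =ᵐ[μ] U := by
        have := Equiv.Perm.image_zpow_ae_eq hT hT' (-1) hTU1
        rw [Equiv.Perm.image_zpow_image_zpow] at this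
        simpa using this.symm
      rw [sub_eq_add_neg, add_comm, ← Equiv.Perm.image_zpow_image_zpow]
      exact (Equiv.Perm.image_zpow_ae_eq hT hT' (-1) ih).trans h1
  have hUc : 0 < μ Uᶜ := by
    rw [pos_iff_ne_zero]
    intro h0
    have := measure_univ_le_add_compl U (μ := μ)
    rw [hinf, h0, add_zero, top_le_iff] at this
    exact hUf this
  obtain ⟨G, hG, hGU, hG0, hGf⟩ := Measure.exists_subset_measure_lt_top hUm.compl hUc
  obtain ⟨j', ⟨I, hI, hIU⟩, I', hI', hIG⟩ :=
    ((H.eventually_ae_eq_towerUnion hc0 hT hT' hc hUm hUf).and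
      (H.eventually_ae_eq_towerUnion hc0 hT hT' hc hG hGf.ne)).exists
  have hne : ∀ {A : Set X} {J : Finset ℕ}, μ A ≠ 0 → A =ᵐ[μ] towerUnion T (E j') J →
      ∃ i ∈ J, μ (⇑(T ^ (i : ℤ)) '' E j') ≠ 0 := by
    intro A J hA0 hAJ
    by_contra! hcon
    refine hA0 ((measure_congr hAJ).trans ?_)
    exact (measure_biUnion_null_iff J.countable_toSet).2 hcon
  obtain ⟨i, hi, hi0⟩ := hne hU0 hIU
  obtain ⟨i', hi', hi0'⟩ := hne hG0.ne' hIG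
  have h1 : ⇑(T ^ (i : ℤ)) '' E j' ≤ᵐ[μ] U :=
    (subset_towerUnion T (E j') hi).eventuallyLE.trans hIU.symm.le
  have h2 : ⇑(T ^ (i' : ℤ)) '' E j' ≤ᵐ[μ] G :=
    (subset_towerUnion T (E j') hi').eventuallyLE.trans hIG.symm.le
  have h3 := (Equiv.Perm.image_zpow_ae_le hT hT' ((i' : ℤ) - i) h1).trans (hTUn _).le
  rw [Equiv.Perm.image_zpow_image_zpow, sub_add_cancel] at h3
  refine hi0' (measure_mono_null (fun x hx => ?_)
    (measure_union_null (ae_le_set.1 h2) (ae_le_set.1 h3)))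
  by_cases hxG : x ∈ G
  · exact Or.inr ⟨hx, hGU hxG⟩
  · exact Or.inl ⟨hx, hxG⟩

theorem tendsto_boundary (H : IsRankOneTower μ T E h) (hinf : μ univ = ∞) [SigmaFinite μ]
    (hT : MeasurePreserving T μ μ) (hT' : Measurable T.symm) {A : Set X} (hA : MeasurableSet A)
    (hAf : μ A ≠ ∞) :
    Tendsto (fun j => μ (A ∩ ⇑(T ^ (h j : ℤ)) '' E j)) atTop (𝓝 0) ∧
      Tendsto (fun j => μ (A ∩ ⇑(T ^ (-1 : ℤ)) '' E j)) atTop (𝓝 0) := by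
  by_cases hsmall : ∀ c : ℝ≥0∞, 0 < c → ∃ B, MeasurableSet B ∧ μ B < c ∧ μ B ≠ 0
  · have hE : Tendsto (fun j => μ (E j)) atTop (𝓝 0) := by
      refine ENNReal.tendsto_nhds_zero.2 fun ε hε => ?_
      obtain ⟨B, hB, hBε, hB0⟩ := hsmall (ε / 2) (ENNReal.half_pos hε.ne')
      filter_upwards [H.eventually_base_le hT hT' hB hBε.ne_top hB0] with j hj
      calc μ (E j) ≤ 2 * μ B := hj
        _ ≤ 2 * (ε / 2) := by gcongr
        _ = ε := ENNReal.mul_div_cancel (by simp) (by simp)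
    constructor
    all_goals
      refine tendsto_of_tendsto_of_tendsto_of_le_of_le tendsto_const_nhds hE
        (fun _ => zero_le) fun j => (measure_mono inter_subset_right).trans ?_
      exact (Equiv.Perm.measure_image_zpow hT hT' _ (H.measurableSet j)).le
  · push Not at hsmall
    obtain ⟨c, hc0, hc⟩ := hsmall
    have hTA : MeasurableSet (⇑(T ^ (1 : ℤ)) '' A) :=
      Equiv.Perm.measurableSet_image_zpow hT hT' 1 hA
    have hTAf : μ (⇑(T ^ (1 : ℤ)) '' A) ≠ ∞ := by
      rwa [Equiv.Perm.measure_image_zpow hT hT' 1 hA]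
    obtain ⟨B, hB, -, hB0, hBf⟩ := Measure.exists_subset_measure_lt_top (μ := μ) (r := 0)
      MeasurableSet.univ (by rw [hinf]; simp)
    have hev : ∀ᶠ j in atTop, μ (A ∩ ⇑(T ^ (h j : ℤ)) '' E j) = 0 ∧
        μ (A ∩ ⇑(T ^ (-1 : ℤ)) '' E j) = 0 := by
      filter_upwards [H.eventually_ae_eq_towerUnion hc0 hT hT' hc hA hAf,
        H.eventually_ae_eq_towerUnion hc0 hT hT' hc hTA hTAf,
        H.eventually_base_le hT hT' hB hBf.ne hB0.ne'] with j ⟨I, hI, hIA⟩ ⟨J, hJ, hJA⟩ hjB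
      have hEf : μ (E j) ≠ ∞ := (hjB.trans_lt (ENNReal.mul_lt_top (by simp) hBf)).ne
      have hnc : μ (E j) ≠ 0 → ¬ ⇑(T ^ ((h j : ℤ) + 1)) '' E j ≤ᵐ[μ] E j := fun h0 =>
        H.not_cyclic hinf hT hT' hc0 hc h0 hEf
      have hE0 : ∀ {a : ℤ}, μ (A ∩ ⇑(T ^ a) '' E j) ≠ 0 → μ (E j) ≠ 0 := fun {a} hne h0 => by
        rw [← Equiv.Perm.measure_image_zpow hT hT' a (H.measurableSet j)] at h0
        exact hne (measure_mono_null inter_subset_right h0)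
      constructor <;> by_contra hne
      · have h1 := H.level_ae_le_of_inter_ne_zero hI hIA le_rfl hne
        have h2 := Equiv.Perm.image_zpow_ae_le hT hT' 1 h1
        rw [Equiv.Perm.image_zpow_image_zpow, add_comm] at h2
        have h3 := H.level_ae_le_level hJ hJA (b := 0) (fun i hi hi0 => ⟨by omega, by
          rw [abs_of_nonneg (by omega)]; omega⟩) h2
        refine hnc (hE0 hne) ?_
        simpa using h3
      · have hne' : μ (⇑(T ^ (1 : ℤ)) '' A ∩ ⇑(T ^ ((0 : ℕ) : ℤ)) '' E j) ≠ 0 := by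
          intro h0
          apply hne
          rw [← Equiv.Perm.measure_image_zpow hT hT' 1
            (hA.inter (Equiv.Perm.measurableSet_image_zpow hT hT' _ (H.measurableSet j))),
            image_inter (T ^ (1 : ℤ)).injective, Equiv.Perm.image_zpow_image_zpow]
          simpa using h0
        have h1 := H.level_ae_le_of_inter_ne_zero hJ hJA (Nat.zero_le _) hne'
        have h2 := Equiv.Perm.image_zpow_ae_le hT hT' (-1) h1
        rw [Equiv.Perm.image_zpow_image_zpow, Equiv.Perm.image_zpow_image_zpow] at h2
        simp only [Nat.cast_zero, add_zero, neg_add_cancel, zpow_zero, Equiv.Perm.coe_one,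
          image_id] at h2
        have h3 := H.level_ae_le_level hI hIA (b := h j) (fun i hi hi0 => ⟨by omega, by
          rw [abs_of_neg (by omega)]; omega⟩) h2
        have h4 : ⇑(T ^ (-1 : ℤ)) '' E j =ᵐ[μ] ⇑(T ^ (h j : ℤ)) '' E j := by
          refine ae_eq_of_ae_subset_of_measure_ge h3 ?_
            (Equiv.Perm.measurableSet_image_zpow hT hT' _ (H.measurableSet j)).nullMeasurableSet ?_
          · rw [Equiv.Perm.measure_image_zpow hT hT' _ (H.measurableSet j),
              Equiv.Perm.measure_image_zpow hT hT' _ (H.measurableSet j)]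
          · rwa [Equiv.Perm.measure_image_zpow hT hT' _ (H.measurableSet j)]
        have h5 := Equiv.Perm.image_zpow_ae_eq hT hT' 1 h4
        rw [Equiv.Perm.image_zpow_image_zpow, Equiv.Perm.image_zpow_image_zpow, add_comm 1] at h5
        refine hnc (hE0 hne) ?_
        simpa [add_comm] using h5.symm.le
    exact ⟨tendsto_const_nhds.congr' (hev.mono fun j hj => hj.1.symm),
      tendsto_const_nhds.congr' (hev.mono fun j hj => hj.2.symm)⟩

end IsRankOneTower
end Boundary

section Blocks
variable {X : Type*}

/-- The union of the products `T ^ i E × T ^ i' E` over the pairs `(i, i') ∈ P`. -/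
def blockUnion (T : Equiv.Perm X) (E : Set X) (P : Finset (ℕ × ℕ)) : Set (X × X) :=
  ⋃ p ∈ P, (⇑(T ^ (p.1 : ℤ)) '' E) ×ˢ (⇑(T ^ (p.2 : ℤ)) '' E)

open Classical in
/-- The pairs of `I × I'` whose difference lies in `G`. -/
noncomputable def diffPairs (I I' : Finset ℕ) (G : Set ℤ) : Finset (ℕ × ℕ) :=
  (I ×ˢ I').filter fun p => (p.2 : ℤ) - p.1 ∈ G

/-- The union of the products of levels of the tower of height `h` over `E` whose difference of
indices lies in `G`. -/
noncomputable def towerBlock (T : Equiv.Perm X) (E : Set X) (h : ℕ) (G : Set ℤ) : Set (X × X) :=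
  blockUnion T E (diffPairs (Finset.range (h + 1)) (Finset.range (h + 1)) G)

theorem mem_diffPairs {I I' : Finset ℕ} {G : Set ℤ} {p : ℕ × ℕ} :
    p ∈ diffPairs I I' G ↔ p.1 ∈ I ∧ p.2 ∈ I' ∧ (p.2 : ℤ) - p.1 ∈ G := by
  simp [diffPairs, and_assoc]

variable {T : Equiv.Perm X} {E : Set X} {P : Finset (ℕ × ℕ)} {h : ℕ} {G : Set ℤ}

theorem mem_blockUnion {z : X × X} : z ∈ blockUnion T E P ↔
    ∃ p ∈ P, z.1 ∈ ⇑(T ^ (p.1 : ℤ)) '' E ∧ z.2 ∈ ⇑(T ^ (p.2 : ℤ)) '' E := by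
  simp only [blockUnion, mem_iUnion, exists_prop, mem_prod]

theorem mem_towerBlock {z : X × X} : z ∈ towerBlock T E h G ↔
    ∃ i i' : ℕ, i ≤ h ∧ i' ≤ h ∧ (i' : ℤ) - i ∈ G ∧
      z.1 ∈ ⇑(T ^ (i : ℤ)) '' E ∧ z.2 ∈ ⇑(T ^ (i' : ℤ)) '' E := by
  simp only [towerBlock, mem_blockUnion, mem_diffPairs, Finset.mem_range, Prod.exists,
    Order.lt_add_one_iff]
  simp only [and_assoc]

theorem Equiv.Perm.apply_mem_image_zpow {i k : ℤ} (hk : k = i + 1) {x : X} :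
    T x ∈ ⇑(T ^ k) '' E ↔ x ∈ ⇑(T ^ i) '' E := by
  have h1 : T x = (T ^ (1 : ℤ)) x := by rw [zpow_one]
  rw [hk, add_comm, ← Equiv.Perm.image_zpow_image_zpow, h1, (T ^ (1 : ℤ)).injective.mem_set_image]

theorem towerBlock_diff_preimage_subset :
    towerBlock T E h G \ Prod.map T T ⁻¹' towerBlock T E h G ⊆
      (⇑(T ^ (h : ℤ)) '' E) ×ˢ univ ∪ univ ×ˢ (⇑(T ^ (h : ℤ)) '' E) := by
  rintro ⟨x, y⟩ ⟨hz, hz'⟩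
  obtain ⟨i, i', hi, hi', hG, hx, hy⟩ := mem_towerBlock.1 hz
  by_contra hcon
  simp only [mem_union, mem_prod, mem_univ, and_true, true_and, not_or] at hcon
  have h1 : i ≠ h := by rintro rfl; exact hcon.1 hx
  have h2 : i' ≠ h := by rintro rfl; exact hcon.2 hy
  refine hz' (mem_towerBlock.2 ⟨i + 1, i' + 1, by omega, by omega, ?_, ?_, ?_⟩)
  · rwa [show ((i' + 1 : ℕ) : ℤ) - (i + 1 : ℕ) = i' - i by push_cast; ring]
  · exact (Equiv.Perm.apply_mem_image_zpow (by push_cast; rfl)).2 hx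
  · exact (Equiv.Perm.apply_mem_image_zpow (by push_cast; rfl)).2 hy

theorem preimage_diff_towerBlock_subset :
    Prod.map T T ⁻¹' towerBlock T E h G \ towerBlock T E h G ⊆
      (⇑(T ^ (-1 : ℤ)) '' E) ×ˢ univ ∪ univ ×ˢ (⇑(T ^ (-1 : ℤ)) '' E) := by
  rintro ⟨x, y⟩ ⟨hz, hz'⟩
  obtain ⟨i, i', hi, hi', hG, hx, hy⟩ := mem_towerBlock.1 hz
  by_contra hcon
  simp only [mem_union, mem_prod, mem_univ, and_true, true_and, not_or] at hcon
  have h1 : i ≠ 0 := by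
    rintro rfl
    exact hcon.1 ((Equiv.Perm.apply_mem_image_zpow (by simp)).1 hx)
  have h2 : i' ≠ 0 := by
    rintro rfl
    exact hcon.2 ((Equiv.Perm.apply_mem_image_zpow (by simp)).1 hy)
  refine hz' (mem_towerBlock.2 ⟨i - 1, i' - 1, by omega, by omega, ?_, ?_, ?_⟩)
  · rwa [show ((i' - 1 : ℕ) : ℤ) - (i - 1 : ℕ) = i' - i by omega]
  · exact (Equiv.Perm.apply_mem_image_zpow (by omega)).1 hx
  · exact (Equiv.Perm.apply_mem_image_zpow (by omega)).1 hy

variable [MeasurableSpace X] {μ : Measure X}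

theorem measurableSet_blockUnion (hT : MeasurePreserving T μ μ) (hT' : Measurable T.symm)
    (hE : MeasurableSet E) (P : Finset (ℕ × ℕ)) : MeasurableSet (blockUnion T E P) :=
  P.measurableSet_biUnion fun _ _ => (Equiv.Perm.measurableSet_image_zpow hT hT' _ hE).prod
    (Equiv.Perm.measurableSet_image_zpow hT hT' _ hE)

end Blocks

section WeakLimit
variable {X : Type*} [MeasurableSpace X] {μ : Measure X} {T : Equiv.Perm X} {ν : Measure (X × X)}

theorem IsSelfJoining.measurePreserving (hν : IsSelfJoining μ T ν)
    (hT : MeasurePreserving T μ μ) : MeasurePreserving (Prod.map T T) ν ν :=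
  ⟨hT.measurable.prodMap hT.measurable, hν.1⟩

theorem IsSelfJoining.ergodic (hν : IsSelfJoining μ T ν) (hT : MeasurePreserving T μ μ)
    (herg : ∀ C : Set (X × X), MeasurableSet C → Prod.map T T ⁻¹' C = C → ν C = 0 ∨ ν Cᶜ = 0) :
    Ergodic (Prod.map T T) ν where
  toMeasurePreserving := hν.measurePreserving hT
  aeconst_set C hC hinv := by
    rw [eventuallyConst_set']
    rcases herg C hC hinv with h | h
    · exact Or.inl (ae_eq_empty.2 h)
    · exact Or.inr (ae_eq_univ.2 h)

theorem IsSubmarginal.measure_le_of_subset (hν : IsSubmarginal μ ν) {Y Y' : Set X}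
    {C D L : Set (X × X)} {F : Set X} (hY : MeasurableSet Y) (hY' : MeasurableSet Y')
    (hF : MeasurableSet F) (hC : C ⊆ Y ×ˢ Y') (hD : D \ L ⊆ F ×ˢ univ ∪ univ ×ˢ F) :
    ν (C ∩ D) ≤ ν (C ∩ L) + (μ (Y ∩ F) + μ (Y' ∩ F)) := by
  have hsub : C ∩ D ⊆ C ∩ L ∪ ((Y ∩ F) ×ˢ univ ∪ univ ×ˢ (Y' ∩ F)) := by
    rintro z ⟨hzC, hzD⟩
    by_cases hzL : z ∈ L
    · exact Or.inl ⟨hzC, hzL⟩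
    · have h1 := hC hzC
      have h2 := hD ⟨hzD, hzL⟩
      simp only [mem_union, mem_prod, mem_univ, mem_inter_iff] at h1 h2 ⊢
      tauto
  exact (measure_mono hsub).trans ((measure_union_le _ _).trans (add_le_add le_rfl
    ((measure_union_le _ _).trans (add_le_add (hν.left _ (hY.inter hF))
      (hν.right _ (hY'.inter hF))))))

theorem IsRankOneTower.exists_tendsto_block {E : ℕ → Set X} {h : ℕ → ℕ}
    (H : IsRankOneTower μ T E h) (hinf : μ univ = ∞) [SigmaFinite μ]
    (hT : MeasurePreserving T μ μ) (hT' : Measurable T.symm) (hν : IsSelfJoining μ T ν)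
    (herg : Ergodic (Prod.map T T) ν) (G : ℕ → Set ℤ) {ω : Ultrafilter ℕ} (hω : (ω : Filter ℕ) ≤ atTop) :
    ∃ α : ℝ≥0∞, ∀ C, MeasurableSet C → ν C ≠ ∞ →
      Tendsto (fun j => ν (C ∩ towerBlock T (E j) (h j) (G j))) ω (𝓝 (α * ν C)) := by
  have := hν.isSubmarginal.sigmaFinite
  set D := fun j => towerBlock T (E j) (h j) (G j)
  have hDm : ∀ j, MeasurableSet (D j) := fun j =>
    measurableSet_blockUnion hT hT' (H.measurableSet j) _
  have hSm := hT.measurable.prodMap hT.measurable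
  obtain ⟨m, hmν, hm⟩ := exists_measure_ultrafilter_tendsto ν (fun j => ν.restrict (D j))
    (fun j => Measure.restrict_le_self) ω
  have hm' : ∀ C, MeasurableSet C → ν C ≠ ∞ → Tendsto (fun j => ν (C ∩ D j)) ω (𝓝 (m C)) :=
    fun C hC hCf => (hm C hC hCf).congr fun j => Measure.restrict_apply hC
  have hbd : ∀ Y Y' : Set X, MeasurableSet Y → MeasurableSet Y' → μ Y ≠ ∞ → μ Y' ≠ ∞ →
      ∀ C, MeasurableSet C → C ⊆ Y ×ˢ Y' → m (Prod.map T T ⁻¹' C) = m C := by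
    intro Y Y' hY hY' hYf hYf' C hC hCY
    have hYp : μ (T ⁻¹' Y) ≠ ∞ := by rwa [hT.measure_preimage hY.nullMeasurableSet]
    have hYp' : μ (T ⁻¹' Y') ≠ ∞ := by rwa [hT.measure_preimage hY'.nullMeasurableSet]
    have hCp : Prod.map T T ⁻¹' C ⊆ (T ⁻¹' Y) ×ˢ (T ⁻¹' Y') := fun z hz => hCY hz
    have hCf : ν C ≠ ∞ := ne_top_of_le_ne_top hYf
      ((measure_mono hCY).trans (hν.isSubmarginal.le_left hY _))
    have hpre : ∀ C, MeasurableSet C → ν (Prod.map T T ⁻¹' C) = ν C := fun C hC =>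
      (hν.measurePreserving hT).measure_preimage hC.nullMeasurableSet
    have h1 := hm' C hC hCf
    have h2 := hm' _ (hSm hC) (by rwa [hpre C hC])
    have e1 : ∀ j, ν (Prod.map T T ⁻¹' C ∩ Prod.map T T ⁻¹' D j) = ν (C ∩ D j) := fun j => by
      rw [← preimage_inter, hpre _ (hC.inter (hDm j))]
    have hb := (H.tendsto_boundary hinf hT hT' (hT.measurable hY) hYp)
    have hb' := (H.tendsto_boundary hinf hT hT' (hT.measurable hY') hYp')
    have hlev : ∀ (a : ℤ) (j : ℕ), MeasurableSet (⇑(T ^ a) '' E j) := fun a j =>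
      Equiv.Perm.measurableSet_image_zpow hT hT' a (H.measurableSet j)
    apply le_antisymm
    · refine le_of_tendsto_of_tendsto' h2
        (by simpa only [add_zero] using h1.add ((hb.1.add hb'.1).mono_left hω)) fun j => ?_
      rw [← e1]
      exact hν.isSubmarginal.measure_le_of_subset (hT.measurable hY) (hT.measurable hY')
        (hlev _ j) hCp towerBlock_diff_preimage_subset
    · refine le_of_tendsto_of_tendsto' h1
        (by simpa only [add_zero] using h2.add ((hb.2.add hb'.2).mono_left hω)) fun j => ?_
      rw [← e1]
      exact hν.isSubmarginal.measure_le_of_subset (hT.measurable hY) (hT.measurable hY')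
        (hlev _ j) hCp preimage_diff_towerBlock_subset
  have hmS : MeasurePreserving (Prod.map T T) m m := by
    refine ⟨hSm, (Measure.ext_iff_of_iUnion_eq_univ
      (s := fun n => spanningSets μ n ×ˢ spanningSets μ n) ?_).2 fun n => ?_⟩
    · rw [iUnion_prod_of_monotone (monotone_spanningSets μ) (monotone_spanningSets μ),
        iUnion_spanningSets, univ_prod_univ]
    · have hn := measurableSet_spanningSets μ n
      ext C hC
      rw [Measure.restrict_apply hC, Measure.restrict_apply hC,
        Measure.map_apply hSm (hC.inter (hn.prod hn))]
      exact hbd _ _ hn hn (measure_spanningSets_lt_top μ n).ne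
        (measure_spanningSets_lt_top μ n).ne _ (hC.inter (hn.prod hn)) inter_subset_right
  let Te : X ≃ᵐ X := ⟨T, hT.measurable, hT'⟩
  obtain ⟨α, rfl⟩ := Ergodic.exists_eq_smul_of_le (Te.prodCongr Te) herg hmS hmν
  exact ⟨α, hm'⟩

end WeakLimit

section Counting
variable {X : Type*} [MeasurableSpace X] {μ : Measure X} {T : Equiv.Perm X} {ν : Measure (X × X)}

theorem IsSelfJoining.measure_image_prod (hν : IsSelfJoining μ T ν)
    (hT : MeasurePreserving T μ μ) (hT' : Measurable T.symm) (k : ℕ) {A B : Set X}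
    (hA : MeasurableSet A) (hB : MeasurableSet B) :
    ν ((⇑(T ^ (k : ℤ)) '' A) ×ˢ (⇑(T ^ (k : ℤ)) '' B)) = ν (A ×ˢ B) := by
  have hmp := (hν.measurePreserving hT).iterate k
  have hm := (Equiv.Perm.measurableSet_image_zpow hT hT' k hA).prod
    (Equiv.Perm.measurableSet_image_zpow hT hT' k hB)
  rw [← hmp.measure_preimage hm.nullMeasurableSet, Prod.map_iterate, ← Equiv.Perm.coe_pow,
    ← zpow_natCast]
  congr 1
  ext ⟨x, y⟩
  simp only [mem_preimage, Prod.map_apply, mem_prod, (T ^ (k : ℤ)).injective.mem_set_image]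

theorem IsSelfJoining.measure_level_prod (hν : IsSelfJoining μ T ν)
    (hT : MeasurePreserving T μ μ) (hT' : Measurable T.symm) {E : Set X}
    (hE : MeasurableSet E) (i i' : ℕ) :
    ν ((⇑(T ^ (i : ℤ)) '' E) ×ˢ (⇑(T ^ (i' : ℤ)) '' E)) =
      ν (E ×ˢ (⇑(T ^ ((i' : ℤ) - i)) '' E)) := by
  rw [← hν.measure_image_prod hT hT' i hE (Equiv.Perm.measurableSet_image_zpow hT hT' _ hE),
    Equiv.Perm.image_zpow_image_zpow, add_sub_cancel]

namespace IsRankOneTower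
variable {E : ℕ → Set X} {h : ℕ → ℕ}

theorem level_unique (H : IsRankOneTower μ T E h) {j i i' : ℕ} (hi : i ≤ h j) (hi' : i' ≤ h j)
    {x : X} (hx : x ∈ ⇑(T ^ (i : ℤ)) '' E j) (hx' : x ∈ ⇑(T ^ (i' : ℤ)) '' E j) : i = i' := by
  by_contra hne
  exact (H.disjoint j i i' hi hi' hne).le_bot ⟨hx, hx'⟩

theorem towerUnion_prod_inter_towerBlock (H : IsRankOneTower μ T E h) {j : ℕ} {I I' : Finset ℕ}
    (hI : ∀ i ∈ I, i ≤ h j) (hI' : ∀ i ∈ I', i ≤ h j) (G : Set ℤ) :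
    (towerUnion T (E j) I ×ˢ towerUnion T (E j) I') ∩ towerBlock T (E j) (h j) G =
      blockUnion T (E j) (diffPairs I I' G) := by
  ext ⟨x, y⟩
  simp only [mem_inter_iff, mem_prod, mem_towerUnion, mem_towerBlock, mem_blockUnion,
    mem_diffPairs, Prod.exists]
  constructor
  · rintro ⟨⟨⟨a, ha, hxa⟩, b, hb, hyb⟩, i, i', hi, hi', hG, hx, hy⟩
    obtain rfl := H.level_unique (hI a ha) hi hxa hx
    obtain rfl := H.level_unique (hI' b hb) hi' hyb hy
    exact ⟨a, b, ⟨ha, hb, hG⟩, hx, hy⟩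
  · rintro ⟨a, b, ⟨ha, hb, hG⟩, hx, hy⟩
    exact ⟨⟨⟨a, ha, hx⟩, b, hb, hy⟩, a, b, hI a ha, hI' b hb, hG, hx, hy⟩

theorem measure_blockUnion_diffPairs (H : IsRankOneTower μ T E h) (hν : IsSelfJoining μ T ν)
    (hT : MeasurePreserving T μ μ) (hT' : Measurable T.symm) {j : ℕ} {I I' : Finset ℕ}
    (hI : ∀ i ∈ I, i ≤ h j) (hI' : ∀ i ∈ I', i ≤ h j) (G : Set ℤ) :
    ν (blockUnion T (E j) (diffPairs I I' G)) =
      ∑ k ∈ Finset.Icc (-(h j : ℤ)) (h j), G.indicator (fun k =>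
        (diffPairs I I' {k}).card * ν (E j ×ˢ (⇑(T ^ k) '' E j))) k := by
  rw [blockUnion, measure_biUnion_finset]
  · have hmap : ∀ p ∈ diffPairs I I' G, (p.2 : ℤ) - p.1 ∈ Finset.Icc (-(h j : ℤ)) (h j) := by
      intro p hp
      have hp' := mem_diffPairs.1 hp
      have h1 := hI _ hp'.1
      have h2 := hI' _ hp'.2.1
      rw [Finset.mem_Icc]
      omega
    rw [← Finset.sum_fiberwise_of_maps_to hmap]
    refine Finset.sum_congr rfl fun k _ => ?_
    by_cases hk : k ∈ G
    · rw [indicator_of_mem hk, ← nsmul_eq_mul, ← Finset.sum_const]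
      refine Finset.sum_congr ?_ fun p hp => ?_
      · ext p
        simp only [Finset.mem_filter, mem_diffPairs, mem_singleton_iff]
        constructor
        · rintro ⟨⟨h1, h2, -⟩, h3⟩
          exact ⟨h1, h2, h3⟩
        · rintro ⟨h1, h2, h3⟩
          exact ⟨⟨h1, h2, h3 ▸ hk⟩, h3⟩
      · rw [hν.measure_level_prod hT hT' (H.measurableSet j)]
        have := (mem_diffPairs.1 hp).2.2
        rw [mem_singleton_iff.1 this]
    · rw [indicator_of_notMem hk]
      refine Finset.sum_eq_zero fun p hp => ?_
      obtain ⟨h1, rfl⟩ := Finset.mem_filter.1 hp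
      exact absurd (mem_diffPairs.1 h1).2.2 hk
  · intro p hp q hq hpq
    refine Set.disjoint_left.2 fun z hz hz' => hpq ?_
    have hp' := mem_diffPairs.1 hp
    have hq' := mem_diffPairs.1 hq
    exact Prod.ext (H.level_unique (hI _ hp'.1) (hI _ hq'.1) hz.1 hz'.1)
      (H.level_unique (hI' _ hp'.2.1) (hI' _ hq'.2.1) hz.2 hz'.2)
  · exact fun p _ => (Equiv.Perm.measurableSet_image_zpow hT hT' _ (H.measurableSet j)).prod
      (Equiv.Perm.measurableSet_image_zpow hT hT' _ (H.measurableSet j))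

theorem card_diffPairs_mul_le (H : IsRankOneTower μ T E h)
    (hT : MeasurePreserving T μ μ) (hT' : Measurable T.symm) {j : ℕ} {I I' : Finset ℕ}
    (hI : ∀ i ∈ I, i ≤ h j) (k : ℤ) :
    (diffPairs I I' {k}).card * μ (E j) ≤
      graphMeasure μ T k (towerUnion T (E j) I ×ˢ towerUnion T (E j) I') := by
  rw [graphMeasure_prod hT hT' k (measurableSet_towerUnion hT hT' (H.measurableSet j) I)
    (measurableSet_towerUnion hT hT' (H.measurableSet j) I')]
  calc ((diffPairs I I' {k}).card : ℝ≥0∞) * μ (E j)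
      = ∑ p ∈ diffPairs I I' {k}, μ (⇑(T ^ (p.1 : ℤ)) '' E j) := by
        rw [← nsmul_eq_mul, ← Finset.sum_const]
        exact Finset.sum_congr rfl fun p _ =>
          (Equiv.Perm.measure_image_zpow hT hT' _ (H.measurableSet j)).symm
    _ = μ (⋃ p ∈ diffPairs I I' {k}, ⇑(T ^ (p.1 : ℤ)) '' E j) := by
        rw [measure_biUnion_finset]
        · intro p hp q hq hpq
          have hp' := mem_diffPairs.1 hp
          have hq' := mem_diffPairs.1 hq
          refine H.disjoint j _ _ (hI _ hp'.1) (hI _ hq'.1) fun h1 => hpq (Prod.ext h1 ?_)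
          have h2 := mem_singleton_iff.1 hp'.2.2
          have h3 := mem_singleton_iff.1 hq'.2.2
          omega
        · exact fun p _ => Equiv.Perm.measurableSet_image_zpow hT hT' _ (H.measurableSet j)
    _ ≤ _ := by
        refine measure_mono (iUnion₂_subset fun p hp => ?_)
        have hp' := mem_diffPairs.1 hp
        rintro _ ⟨y, hy, rfl⟩
        refine ⟨mem_towerUnion.2 ⟨p.1, hp'.1, y, hy, rfl⟩, mem_towerUnion.2 ⟨p.2, hp'.2.1, y, hy, ?_⟩⟩
        rw [← Equiv.Perm.mul_apply, ← zpow_add, ← mem_singleton_iff.1 hp'.2.2, sub_add_cancel]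

theorem mul_measure_block_le (H : IsRankOneTower μ T E h) (hν : IsSelfJoining μ T ν)
    (hT : MeasurePreserving T μ μ) (hT' : Measurable T.symm) {j : ℕ} {I I₁ I₂ : Finset ℕ}
    (hI : ∀ i ∈ I, i ≤ h j) (hI₁ : ∀ i ∈ I₁, i ≤ h j) (hI₂ : ∀ i ∈ I₂, i ≤ h j) {G : Set ℤ}
    {a r : ℝ≥0∞}
    (ha : ∀ k ∈ G, a ≤ (diffPairs I (Finset.range (h j + 1)) {k}).card * μ (E j))
    (hr : ∀ k ∈ G, graphMeasure μ T k (towerUnion T (E j) I₁ ×ˢ towerUnion T (E j) I₂) ≤ r) :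
    a * ν (blockUnion T (E j) (diffPairs I₁ I₂ G)) ≤
      r * ν (blockUnion T (E j) (diffPairs I (Finset.range (h j + 1)) G)) := by
  rw [H.measure_blockUnion_diffPairs hν hT hT' hI₁ hI₂,
    H.measure_blockUnion_diffPairs hν hT hT' hI fun i hi => Nat.lt_succ_iff.1 (Finset.mem_range.1 hi),
    Finset.mul_sum, Finset.mul_sum]
  refine Finset.sum_le_sum fun k _ => ?_
  by_cases hk : k ∈ G
  · rw [indicator_of_mem hk, indicator_of_mem hk, ← mul_assoc, ← mul_assoc]
    refine mul_le_mul_left ?_ _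
    calc a * (diffPairs I₁ I₂ {k}).card
        ≤ (diffPairs I (Finset.range (h j + 1)) {k}).card * μ (E j) * (diffPairs I₁ I₂ {k}).card :=
          mul_le_mul_left (ha k hk) _
      _ = (diffPairs I₁ I₂ {k}).card * μ (E j) * (diffPairs I (Finset.range (h j + 1)) {k}).card := by
          ring
      _ ≤ _ := mul_le_mul_left ((H.card_diffPairs_mul_le hT hT' hI₁ k).trans (hr k hk)) _
  · simp [indicator_of_notMem hk]

theorem measure_towerUnion_le (H : IsRankOneTower μ T E h)
    (hT : MeasurePreserving T μ μ) (hT' : Measurable T.symm) (j : ℕ) (I : Finset ℕ) :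
    μ (towerUnion T (E j) I) ≤ I.card * μ (E j) := by
  refine (measure_biUnion_finset_le _ _).trans_eq ?_
  rw [← nsmul_eq_mul, ← Finset.sum_const]
  exact Finset.sum_congr rfl fun i _ =>
    Equiv.Perm.measure_image_zpow hT hT' _ (H.measurableSet j)

theorem measure_block_le (H : IsRankOneTower μ T E h) (hν : IsSubmarginal μ ν)
    (hT : MeasurePreserving T μ μ) (hT' : Measurable T.symm) {j : ℕ} {I : Finset ℕ}
    (hI : ∀ i ∈ I, i ≤ h j) {G : Set ℤ} {a : ℝ≥0∞}
    (ha : ∀ k ∈ G, (diffPairs I (Finset.range (h j + 1)) {k}).card * μ (E j) ≤ a) :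
    ν (blockUnion T (E j) (diffPairs I (Finset.range (h j + 1)) G)) ≤ 2 * a := by
  classical
  have hcard : ∀ (S : Finset ℕ) (k : ℤ), k ∈ G →
      (∀ i ∈ S, i ∈ I ∧ ∃ i' : ℕ, i' ≤ h j ∧ (i' : ℤ) - i = k) →
      μ (towerUnion T (E j) S) ≤ a := by
    intro S k hk hS
    refine (H.measure_towerUnion_le hT hT' j S).trans (le_trans ?_ (ha k hk))
    refine mul_le_mul_left (Nat.cast_le.2 ?_) _
    choose! hSI f hf hfk using hS
    refine Finset.card_le_card_of_injOn (fun i => (i, f i)) (fun i hi => ?_) fun i _ i' _ hii =>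
      congrArg Prod.fst hii
    exact mem_diffPairs.2 ⟨hSI i hi, Finset.mem_range.2 (Nat.lt_succ_of_le (hf i hi)), hfk i hi⟩
  set S₀ := I.filter fun i => ∃ i' : ℕ, i' ≤ h j ∧ i ≤ i' ∧ (i' : ℤ) - i ∈ G
  set S₁ := I.filter fun i => ∃ i' : ℕ, i' ≤ h j ∧ i' < i ∧ (i' : ℤ) - i ∈ G
  have h0 : μ (towerUnion T (E j) S₀) ≤ a := by
    rcases S₀.eq_empty_or_nonempty with he | hne
    · simp [he, towerUnion]
    · obtain ⟨-, i', hi', hle, hG⟩ := Finset.mem_filter.1 (S₀.max'_mem hne)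
      refine hcard S₀ _ hG fun i hi => ⟨(Finset.mem_filter.1 hi).1, ?_⟩
      have := S₀.le_max' i hi
      exact ⟨i' - S₀.max' hne + i, by omega, by omega⟩
  have h1 : μ (towerUnion T (E j) S₁) ≤ a := by
    rcases S₁.eq_empty_or_nonempty with he | hne
    · simp [he, towerUnion]
    · obtain ⟨-, i', hi', hlt, hG⟩ := Finset.mem_filter.1 (S₁.min'_mem hne)
      refine hcard S₁ _ hG fun i hi => ⟨(Finset.mem_filter.1 hi).1, ?_⟩
      have := S₁.min'_le i hi
      have := hI i (Finset.mem_filter.1 hi).1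
      exact ⟨i - (S₁.min' hne - i'), by omega, by omega⟩
  have hsub : blockUnion T (E j) (diffPairs I (Finset.range (h j + 1)) G) ⊆
      towerUnion T (E j) S₀ ×ˢ univ ∪ towerUnion T (E j) S₁ ×ˢ univ := by
    rintro z hz
    obtain ⟨p, hp, hz1, hz2⟩ := mem_blockUnion.1 hz
    obtain ⟨hpI, hpr, hpG⟩ := mem_diffPairs.1 hp
    have hpr' := Nat.lt_succ_iff.1 (Finset.mem_range.1 hpr)
    rcases le_or_gt p.1 p.2 with hle | hlt
    · exact Or.inl ⟨mem_towerUnion.2 ⟨p.1, Finset.mem_filter.2 ⟨hpI, p.2, hpr', hle, hpG⟩, hz1⟩,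
        trivial⟩
    · exact Or.inr ⟨mem_towerUnion.2 ⟨p.1, Finset.mem_filter.2 ⟨hpI, p.2, hpr', hlt, hpG⟩, hz1⟩,
        trivial⟩
  have hm := measurableSet_towerUnion hT hT' (H.measurableSet j)
  rw [two_mul]
  exact (measure_mono hsub).trans ((measure_union_le _ _).trans (add_le_add
    ((hν.left _ (hm S₀)).trans h0) ((hν.left _ (hm S₁)).trans h1)))

theorem tendsto_prod_univ_diff (H : IsRankOneTower μ T E h) [SigmaFinite μ]
    (hν : IsSubmarginal μ ν) (hT : MeasurePreserving T μ μ) (hT' : Measurable T.symm)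
    {A : Set X} (hA : MeasurableSet A) (hAf : μ A ≠ ∞) :
    Tendsto (fun j => ν (A ×ˢ univ \ towerUnion T (E j) (Finset.range (h j + 1)) ×ˢ
      towerUnion T (E j) (Finset.range (h j + 1)))) atTop (𝓝 0) := by
  set U := fun j => towerUnion T (E j) (Finset.range (h j + 1))
  have hU : ∀ j, MeasurableSet (U j) := fun j =>
    measurableSet_towerUnion hT hT' (H.measurableSet j) _
  have htail : Tendsto (fun n => ν (A ×ˢ (spanningSets μ n)ᶜ)) atTop (𝓝 0) := by
    have := tendsto_measure_iInter_atTop (μ := ν) (s := fun n => A ×ˢ (spanningSets μ n)ᶜ)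
      (fun n => (hA.prod (measurableSet_spanningSets μ n).compl).nullMeasurableSet)
      (fun m n hmn => prod_mono le_rfl (compl_subset_compl.2 (monotone_spanningSets μ hmn)))
      ⟨0, ne_top_of_le_ne_top hAf (hν.le_left hA _)⟩
    rwa [← prod_iInter, ← compl_iUnion, iUnion_spanningSets, compl_univ, prod_empty,
      measure_empty] at this
  refine ENNReal.tendsto_nhds_zero.2 fun ε hε => ?_
  obtain ⟨n, hn⟩ := (ENNReal.tendsto_nhds_zero.1 htail (ε / 2) (ENNReal.half_pos hε.ne')).exists
  have hB := measurableSet_spanningSets μ n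
  have hlim : Tendsto (fun j => μ (A \ U j) + μ (spanningSets μ n \ U j)) atTop (𝓝 0) := by
    simpa only [add_zero] using (H.tendsto_diff_full hA hAf).add
      (H.tendsto_diff_full hB (measure_spanningSets_lt_top μ n).ne)
  filter_upwards [ENNReal.tendsto_nhds_zero.1 hlim (ε / 2) (ENNReal.half_pos hε.ne')] with j hj
  have hsub : A ×ˢ univ \ U j ×ˢ U j ⊆ A ×ˢ (spanningSets μ n)ᶜ ∪
      ((A \ U j) ×ˢ univ ∪ univ ×ˢ (spanningSets μ n \ U j)) := by
    rintro ⟨x, y⟩ hz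
    simp only [Set.mem_sdiff, mem_prod, mem_univ, mem_union, mem_compl_iff, and_true, true_and] at hz ⊢
    tauto
  calc _ ≤ _ := measure_mono hsub
    _ ≤ _ := (measure_union_le _ _).trans (add_le_add hn ((measure_union_le _ _).trans
      (add_le_add (hν.left _ (hA.diff (hU j))) (hν.right _ (hB.diff (hU j))))))
    _ ≤ ε / 2 + ε / 2 := add_le_add le_rfl hj
    _ = ε := ENNReal.add_halves ε

end IsRankOneTower
end Counting

section HalfBound
variable {X : Type*} [MeasurableSpace X] {μ : Measure X} {T : Equiv.Perm X} {ν : Measure (X × X)}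

theorem ENNReal.exists_lt_half_forall_lt_mul {ι : Type*} [Finite ι] (c v : ι → ℝ≥0∞)
    (hv : ∀ l, v l ≠ ∞) :
    ∃ θ : ℝ≥0∞, 2 * θ < 1 ∧ ∀ l, c l < v l / 2 → c l < θ * v l := by
  have hlim : ∀ l, ∀ᶠ θ in 𝓝[<] (2⁻¹ : ℝ≥0∞), c l < v l / 2 → c l < θ * v l := by
    intro l
    by_cases hc : c l < v l / 2
    · have : Tendsto (fun θ : ℝ≥0∞ => θ * v l) (𝓝[<] 2⁻¹) (𝓝 (2⁻¹ * v l)) :=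
        (ENNReal.Tendsto.mul_const tendsto_id (Or.inr (hv l))).mono_left nhdsWithin_le_nhds
      refine (this.eventually_const_lt ?_).mono fun θ hθ _ => hθ
      rwa [mul_comm, ← div_eq_mul_inv]
    · exact Eventually.of_forall fun θ h => absurd h hc
  have : (𝓝[<] (2⁻¹ : ℝ≥0∞)).NeBot := nhdsLT_neBot_of_exists_lt ⟨0, by simp⟩
  obtain ⟨θ, hθ, hlt⟩ := ((eventually_all.2 hlim).and self_mem_nhdsWithin).exists
  refine ⟨θ, ?_, hθ⟩
  rw [mul_comm, ← ENNReal.inv_mul_cancel two_ne_zero ENNReal.ofNat_ne_top]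
  exact (ENNReal.mul_lt_mul_iff_left two_ne_zero ENNReal.ofNat_ne_top).2 hlt

theorem MeasureTheory.Measure.exists_measurableSet_measure_ne_zero_ne_top (μ : Measure X) [SigmaFinite μ]
    (h0 : μ univ ≠ 0) : ∃ A, MeasurableSet A ∧ μ A ≠ 0 ∧ μ A ≠ ∞ := by
  by_contra! hcon
  refine h0 ?_
  rw [← iUnion_spanningSets μ, measure_iUnion_null_iff]
  intro n
  by_contra hne
  exact (measure_spanningSets_lt_top μ n).ne (hcon _ (measurableSet_spanningSets μ n) hne)

/-- On finitely many rectangles, some graph measure of an infinite rank-one transformation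
dominates half of an ergodic self-joining up to a small error. -/
theorem IsRankOneTower.exists_half_le_graphMeasure {E : ℕ → Set X} {h : ℕ → ℕ}
    (H : IsRankOneTower μ T E h) (hinf : μ univ = ∞) [SigmaFinite μ]
    (hT : MeasurePreserving T μ μ) (hT' : Measurable T.symm) (hν : IsSelfJoining μ T ν)
    (herg : Ergodic (Prod.map T T) ν) {ι : Type*} [Fintype ι] (A B : ι → Set X)
    (hA : ∀ l, MeasurableSet (A l)) (hB : ∀ l, MeasurableSet (B l)) (hAf : ∀ l, μ (A l) ≠ ∞)
    (hBf : ∀ l, μ (B l) ≠ ∞) {ε : ℝ≥0∞} (hε : ε ≠ 0) :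
    ∃ k : ℤ, ∀ l, ν (A l ×ˢ B l) / 2 ≤ graphMeasure μ T k (A l ×ˢ B l) + ε := by
  by_contra! hcon
  choose l hl using hcon
  have hsub := hν.isSubmarginal
  have hνf : ∀ i, ν (A i ×ˢ B i) ≠ ∞ := fun i =>
    ne_top_of_le_ne_top (hAf i) (hsub.le_left (hA i) _)
  set c : ι → ℝ≥0∞ := fun i => ν (A i ×ˢ B i) / 2 - ε with hcdef
  have hcf : ∀ i, c i ≠ ∞ := fun i =>
    ne_top_of_le_ne_top (ENNReal.div_ne_top (hνf i) (by simp)) tsub_le_self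
  have hεf : ε ≠ ∞ := ne_top_of_lt (lt_of_le_of_lt le_add_self (hl 0))
  have hgc : ∀ k, graphMeasure μ T k (A (l k) ×ˢ B (l k)) ≤ c (l k) := fun k =>
    ENNReal.le_sub_of_add_le_right hεf (hl k).le
  have hc : ∀ k, c (l k) < ν (A (l k) ×ˢ B (l k)) / 2 := fun k =>
    ENNReal.sub_lt_self (ENNReal.div_ne_top (hνf _) (by simp)) (ne_bot_of_gt (hl k)) hε
  obtain ⟨θ, hθ, hθc⟩ := ENNReal.exists_lt_half_forall_lt_mul c (fun i => ν (A i ×ˢ B i)) hνf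
  have hθf : θ ≠ ∞ := by
    rintro rfl
    simp at hθ
  obtain ⟨Y, hY, hY0, hYf⟩ := MeasureTheory.Measure.exists_measurableSet_measure_ne_zero_ne_top μ
    (by rw [hinf]; exact ENNReal.top_ne_zero)
  obtain ⟨I, hI, hIY⟩ := H.exists_tendsto hY hYf
  choose I₁ hI₁ hIA using fun i => H.exists_tendsto (hA i) (hAf i)
  choose I₂ hI₂ hIB using fun i => H.exists_tendsto (hB i) (hBf i)
  set R : ℕ → Finset ℕ := fun j => Finset.range (h j + 1) with hR
  have hRle : ∀ j, ∀ i ∈ R j, i ≤ h j := fun j i hi => Nat.lt_succ_iff.1 (Finset.mem_range.1 hi)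
  set W : ℕ → Finset ℕ → Set X := fun j => towerUnion T (E j) with hW
  have hWm : ∀ j J, MeasurableSet (W j J) := fun j J =>
    measurableSet_towerUnion hT hT' (H.measurableSet j) J
  set g : ℕ → Set ℤ := fun j =>
    {k | θ * μ Y ≤ (diffPairs (I j) (R j) {k}).card * μ (E j)} with hg
  set G : ι → ℕ → Set ℤ := fun i j => {k | l k = i} ∩ g j with hG
  set D : ι → ℕ → Set (X × X) := fun i j => towerBlock T (E j) (h j) (G i j) with hD
  set ω : Ultrafilter ℕ := hyperfilter ℕ
  have hω : (ω : Filter ℕ) ≤ atTop := Nat.hyperfilter_le_atTop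
  choose α hα using fun i => H.exists_tendsto_block hinf hT hT' hν herg (G i) hω
  have hνY : ν (Y ×ˢ univ) = μ Y := (hν.2 Y hY hYf.lt_top).1
  have hαY : ∀ i, Tendsto (fun j => ν (Y ×ˢ univ ∩ D i j)) ω (𝓝 (α i * μ Y)) := fun i => by
    have := hα i (Y ×ˢ univ) (hY.prod .univ) (by rwa [hνY])
    rwa [hνY] at this
  have hcover : ∀ j, μ Y ≤ ν (Y ×ˢ univ \ W j (R j) ×ˢ W j (R j)) + μ (Y ∆ W j (I j)) +
      2 * (θ * μ Y) + ∑ i, ν (Y ×ˢ univ ∩ D i j) := by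
    intro j
    have hYsub : Y ×ˢ univ ⊆ ((Y ×ˢ univ \ W j (R j) ×ˢ W j (R j)) ∪ (Y ∆ W j (I j)) ×ˢ univ ∪
        blockUnion T (E j) (diffPairs (I j) (R j) (g j)ᶜ)) ∪ ⋃ i, Y ×ˢ univ ∩ D i j := by
      rintro ⟨x, y⟩ ⟨hx, -⟩
      by_cases hxW : x ∈ W j (I j)
      · by_cases hyW : y ∈ W j (R j)
        · obtain ⟨i, hi, hxi⟩ := mem_towerUnion.1 hxW
          obtain ⟨i', hi', hyi⟩ := mem_towerUnion.1 hyW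
          by_cases hk : (i' : ℤ) - i ∈ g j
          · refine Or.inr (mem_iUnion.2 ⟨l ((i' : ℤ) - i), ⟨hx, trivial⟩, ?_⟩)
            exact mem_towerBlock.2 ⟨i, i', hI j i hi, hRle j i' hi', ⟨rfl, hk⟩, hxi, hyi⟩
          · exact Or.inl (Or.inr (mem_blockUnion.2
              ⟨(i, i'), mem_diffPairs.2 ⟨hi, hi', hk⟩, hxi, hyi⟩))
        · exact Or.inl (Or.inl (Or.inl ⟨⟨hx, trivial⟩, fun hz => hyW hz.2⟩))
      · exact Or.inl (Or.inl (Or.inr ⟨Or.inl ⟨hx, hxW⟩, trivial⟩))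
    rw [← hνY]
    refine (measure_mono hYsub).trans ((measure_union_le _ _).trans (add_le_add
      ((measure_union_le _ _).trans (add_le_add ((measure_union_le _ _).trans (add_le_add le_rfl
        (hsub.left _ (hY.symmDiff (hWm j _))))) ?_)) (measure_iUnion_fintype_le _ _)))
    rw [hνY]
    exact H.measure_block_le hsub hT hT' (hI j) fun k hk =>
      (not_le.1 fun hle => hk hle).le
  have hsum : ∑ i, α i * μ Y ≠ 0 := by
    intro h0
    have hlim : Tendsto (fun j => ν (Y ×ˢ univ \ W j (R j) ×ˢ W j (R j)) + μ (Y ∆ W j (I j)) +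
        2 * (θ * μ Y) + ∑ i, ν (Y ×ˢ univ ∩ D i j)) ω
        (𝓝 (0 + 0 + 2 * (θ * μ Y) + ∑ i, α i * μ Y)) :=
      (((((H.tendsto_prod_univ_diff hsub hT hT' hY hYf).add hIY).mono_left hω).add
        tendsto_const_nhds)).add (tendsto_finsetSum _ fun i _ => hαY i)
    have hle := ge_of_tendsto' hlim hcover
    rw [h0, add_zero, zero_add, zero_add, ← mul_assoc] at hle
    refine hle.not_gt ?_
    conv_rhs => rw [← one_mul (μ Y)]
    exact (ENNReal.mul_lt_mul_iff_left hY0 hYf).2 hθ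
  obtain ⟨i, -, hi⟩ := Finset.exists_ne_zero_of_sum_ne_zero hsum
  have hαf : α i * μ Y ≠ ∞ := ne_top_of_le_ne_top hYf
    (le_of_tendsto' (hαY i) fun j => (measure_mono inter_subset_left).trans hνY.le)
  have hne : ∃ k, l k = i := by
    by_contra! hno
    refine hi (tendsto_nhds_unique (hαY i) ?_)
    refine tendsto_const_nhds.congr fun j => ?_
    have : D i j = ∅ := eq_empty_of_forall_notMem fun z hz => by
      obtain ⟨_, _, -, -, hk, -⟩ := mem_towerBlock.1 hz
      exact hno _ hk.1
    rw [this, inter_empty, measure_empty]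
  have hcount : ∀ j, θ * μ Y * ν ((A i ×ˢ B i) ∩ D i j) ≤
      θ * μ Y * (μ (A i ∆ W j (I₁ i j)) + μ (B i ∆ W j (I₂ i j))) +
        (c i + (μ (A i ∆ W j (I₁ i j)) + μ (B i ∆ W j (I₂ i j)))) *
          (ν (Y ×ˢ univ ∩ D i j) + μ (Y ∆ W j (I j))) := by
    intro j
    have hDm : MeasurableSet (D i j) := measurableSet_blockUnion hT hT' (H.measurableSet j) _
    have hsubD := hsub.restrict (D i j)
    have happ : ∀ {P Q : Set X}, MeasurableSet P → MeasurableSet Q →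
        ν.restrict (D i j) (P ×ˢ Q) = ν (P ×ˢ Q ∩ D i j) := fun hP hQ =>
      Measure.restrict_apply (hP.prod hQ)
    have h1 : ν ((A i ×ˢ B i) ∩ D i j) ≤ ν (blockUnion T (E j) (diffPairs (I₁ i j) (I₂ i j) (G i j)))
        + (μ (A i ∆ W j (I₁ i j)) + μ (B i ∆ W j (I₂ i j))) := by
      rw [← H.towerUnion_prod_inter_towerBlock (hI₁ i j) (hI₂ i j), ← happ (hA i) (hB i),
        ← happ (hWm j _) (hWm j _), ← add_assoc]
      exact hsubD.prod_le_add_symmDiff (hA i) (hWm j _) (hB i) (hWm j _)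
    have h2 : ν (blockUnion T (E j) (diffPairs (I j) (R j) (G i j))) ≤
        ν (Y ×ˢ univ ∩ D i j) + μ (Y ∆ W j (I j)) := by
      rw [← H.towerUnion_prod_inter_towerBlock (hI j) (hRle j), ← happ hY .univ,
        ← happ (hWm j _) (hWm j _), symmDiff_comm]
      refine (measure_mono (prod_mono le_rfl (subset_univ _))).trans ?_
      simpa using hsubD.prod_le_add_symmDiff (hWm j (I j)) hY .univ .univ
    have h3 := H.mul_measure_block_le hν hT hT' (hI j) (hI₁ i j) (hI₂ i j) (G := G i j)
      (a := θ * μ Y) (r := c i + (μ (A i ∆ W j (I₁ i j)) + μ (B i ∆ W j (I₂ i j))))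
      (fun k hk => hk.2) (by
        rintro k ⟨rfl, -⟩
        have := (isSubmarginal_graphMeasure hT hT' k).prod_le_add_symmDiff
          (hWm j (I₁ (l k) j)) (hA (l k)) (hWm j (I₂ (l k) j)) (hB (l k))
        rw [add_assoc, symmDiff_comm, symmDiff_comm (W j _) (B _)] at this
        exact this.trans (add_le_add (hgc k) le_rfl))
    calc _ ≤ θ * μ Y * (_ + _) := mul_le_mul_right h1 _
      _ ≤ _ := by
        rw [mul_add, add_comm]
        exact add_le_add le_rfl (h3.trans (mul_le_mul_right h2 _))
  have hlim : θ * μ Y * (α i * ν (A i ×ˢ B i)) ≤ c i * (α i * μ Y) := by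
    have hτ : Tendsto (fun j => μ (A i ∆ W j (I₁ i j)) + μ (B i ∆ W j (I₂ i j))) ω (𝓝 0) := by
      simpa only [add_zero] using ((hIA i).add (hIB i)).mono_left hω
    have hYf' := ENNReal.mul_ne_top hθf hYf
    have hL : Tendsto (fun j => θ * μ Y * ν ((A i ×ˢ B i) ∩ D i j)) ω
        (𝓝 (θ * μ Y * (α i * ν (A i ×ˢ B i)))) :=
      ENNReal.Tendsto.const_mul (hα i _ ((hA i).prod (hB i)) (hνf i)) (Or.inr hYf')
    have hR₁ := ENNReal.Tendsto.const_mul hτ (Or.inr hYf')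
    have hR₂ := ENNReal.Tendsto.mul ((tendsto_const_nhds (x := c i)).add hτ)
      (Or.inr (by rwa [add_zero])) ((hαY i).add (hIY.mono_left hω))
      (Or.inr (by simpa only [add_zero] using hcf i))
    have := le_of_tendsto_of_tendsto' hL (hR₁.add hR₂) hcount
    simpa only [mul_zero, add_zero, zero_add] using this
  obtain ⟨k, rfl⟩ := hne
  refine hlim.not_gt ?_
  rw [show θ * μ Y * (α (l k) * ν (A (l k) ×ˢ B (l k))) =
    θ * ν (A (l k) ×ˢ B (l k)) * (α (l k) * μ Y) by ring]
  exact (ENNReal.mul_lt_mul_iff_left hi hαf).2 (hθc _ (hc k))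

end HalfBound

section Subsequence
variable {X : Type*} [MeasurableSpace X] {μ : Measure X} {T : Equiv.Perm X} {ν : Measure (X × X)}

theorem IsRankOneTower.exists_dense_seq {E : ℕ → Set X} {h : ℕ → ℕ}
    (H : IsRankOneTower μ T E h) (hT : MeasurePreserving T μ μ) (hT' : Measurable T.symm) :
    ∃ V : ℕ → Set X, (∀ n, MeasurableSet (V n)) ∧ (∀ n, μ (V n) ≠ ∞) ∧
      ∀ A, MeasurableSet A → μ A ≠ ∞ → ∀ ε : ℝ≥0∞, 0 < ε → ∃ n, μ (A ∆ V n) ≤ ε := by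
  have : Nonempty {p : ℕ × Finset ℕ // μ (towerUnion T (E p.1) p.2) ≠ ∞} :=
    ⟨⟨(0, ∅), by simp [towerUnion]⟩⟩
  obtain ⟨q, hq⟩ := exists_surjective_nat {p : ℕ × Finset ℕ // μ (towerUnion T (E p.1) p.2) ≠ ∞}
  refine ⟨fun n => towerUnion T (E (q n).1.1) (q n).1.2, fun n =>
    measurableSet_towerUnion hT hT' (H.measurableSet _) _, fun n => (q n).2,
    fun A hA hAf ε hε => ?_⟩
  obtain ⟨I, -, hI⟩ := H.exists_tendsto hA hAf
  obtain ⟨j, hjε, hj1⟩ := ((ENNReal.tendsto_nhds_zero.1 hI ε hε).and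
    (ENNReal.tendsto_nhds_zero.1 hI 1 one_pos)).exists
  have hfin : μ (towerUnion T (E j) (I j)) ≠ ∞ := by
    refine ne_top_of_le_ne_top (ENNReal.add_ne_top.2 ⟨hAf, ENNReal.one_ne_top⟩)
      ((measure_mono (t := A ∪ A ∆ towerUnion T (E j) (I j)) fun x hx => ?_).trans
        ((measure_union_le _ _).trans (add_le_add le_rfl hj1)))
    simp only [mem_union, mem_symmDiff]
    tauto
  obtain ⟨n, hn⟩ := hq ⟨(j, I j), hfin⟩
  exact ⟨n, by simpa only [hn] using hjε⟩

/-- A sequence of submarginal measures converging on a dense family of rectangles converges on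
all rectangles with sides of finite measure. -/
theorem IsSubmarginal.exists_tendsto_of_dense {D : ℕ → Measure (X × X)}
    (hD : ∀ n, IsSubmarginal μ (D n)) {P Q : ℕ → Set X} (hP : ∀ l, MeasurableSet (P l))
    (hQ : ∀ l, MeasurableSet (Q l))
    (hdense : ∀ A B, MeasurableSet A → MeasurableSet B → μ A ≠ ∞ → μ B ≠ ∞ → ∀ ε : ℝ≥0∞, 0 < ε →
      ∃ l, μ (A ∆ P l) + μ (B ∆ Q l) ≤ ε) {a : ℕ → ℝ≥0∞}
    (ha : ∀ l, Tendsto (fun n => D n (P l ×ˢ Q l)) atTop (𝓝 (a l))) {A B : Set X}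
    (hA : MeasurableSet A) (hB : MeasurableSet B) (hAf : μ A ≠ ∞) (hBf : μ B ≠ ∞) :
    ∃ c, Tendsto (fun n => D n (A ×ˢ B)) atTop (𝓝 c) ∧
      ∀ l, a l ≤ c + (μ (A ∆ P l) + μ (B ∆ Q l)) := by
  have key : ∀ (ω : Ultrafilter ℕ), (ω : Filter ℕ) ≤ atTop → ∀ c,
      Tendsto (fun n => D n (A ×ˢ B)) ω (𝓝 c) → ∀ l,
        c ≤ a l + (μ (A ∆ P l) + μ (B ∆ Q l)) ∧ a l ≤ c + (μ (A ∆ P l) + μ (B ∆ Q l)) := by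
    intro ω hω c hc l
    have hal := (ha l).mono_left hω
    constructor
    · refine le_of_tendsto_of_tendsto' hc (hal.add tendsto_const_nhds) fun n => ?_
      rw [← add_assoc]
      exact (hD n).prod_le_add_symmDiff hA (hP l) hB (hQ l)
    · refine le_of_tendsto_of_tendsto' hal (hc.add tendsto_const_nhds) fun n => ?_
      rw [← add_assoc, symmDiff_comm, symmDiff_comm B]
      exact (hD n).prod_le_add_symmDiff (hP l) hA (hQ l) hB
  have huniq : ∀ ω ω' : Ultrafilter ℕ, (ω : Filter ℕ) ≤ atTop → (ω' : Filter ℕ) ≤ atTop →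
      ∀ c c', Tendsto (fun n => D n (A ×ˢ B)) ω (𝓝 c) →
        Tendsto (fun n => D n (A ×ˢ B)) ω' (𝓝 c') → c ≤ c' := by
    intro ω ω' hω hω' c c' hc hc'
    refine ENNReal.le_of_forall_pos_le_add fun ε hε _ => ?_
    obtain ⟨l, hl⟩ := hdense A B hA hB hAf hBf (ε / 2) (ENNReal.half_pos (by positivity))
    calc c ≤ a l + ε / 2 := ((key ω hω c hc l).1).trans (add_le_add le_rfl hl)
      _ ≤ c' + ε / 2 + ε / 2 :=
        add_le_add (((key ω' hω' c' hc' l).2).trans (add_le_add le_rfl hl)) le_rfl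
      _ = c' + ε := by rw [add_assoc, ENNReal.add_halves]
  obtain ⟨c, hc⟩ := (hyperfilter ℕ).exists_tendsto_ennreal fun n => D n (A ×ˢ B)
  have hω := Nat.hyperfilter_le_atTop
  refine ⟨c, (tendsto_iff_ultrafilter _ _ _).2 fun ω' hω' => ?_, fun l => (key _ hω c hc l).2⟩
  obtain ⟨c', hc'⟩ := ω'.exists_tendsto_ennreal fun n => D n (A ×ˢ B)
  rwa [le_antisymm (huniq _ _ hω hω' c c' hc hc') (huniq _ _ hω' hω c' c hc' hc)]

theorem IsRankOneTower.exists_half_limit {E : ℕ → Set X} {h : ℕ → ℕ}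
    (H : IsRankOneTower μ T E h) (hinf : μ univ = ∞) [StandardBorelSpace X] [SigmaFinite μ]
    (hT : MeasurePreserving T μ μ) (hT' : Measurable T.symm) (hν : IsSelfJoining μ T ν)
    (herg : Ergodic (Prod.map T T) ν) :
    ∃ (k : ℕ → ℤ) (ν' : Measure (X × X)),
      ∀ A B : Set X, MeasurableSet A → MeasurableSet B → μ A ≠ ∞ → μ B ≠ ∞ →
        Tendsto (fun j => graphMeasure μ T (k j) (A ×ˢ B)) atTop
          (𝓝 (ν (A ×ˢ B) / 2 + ν' (A ×ˢ B))) := by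
  obtain ⟨V, hVm, hVf, hV⟩ := H.exists_dense_seq hT hT'
  set P : ℕ → Set X := fun l => V l.unpair.1
  set Q : ℕ → Set X := fun l => V l.unpair.2
  have hsub := hν.isSubmarginal
  have hdense : ∀ A B, MeasurableSet A → MeasurableSet B → μ A ≠ ∞ → μ B ≠ ∞ →
      ∀ ε : ℝ≥0∞, 0 < ε → ∃ l, μ (A ∆ P l) + μ (B ∆ Q l) ≤ ε := by
    intro A B hA hB hAf hBf ε hε
    obtain ⟨m, hm⟩ := hV A hA hAf (ε / 2) (ENNReal.half_pos hε.ne')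
    obtain ⟨n, hn⟩ := hV B hB hBf (ε / 2) (ENNReal.half_pos hε.ne')
    refine ⟨Nat.pair m n, ?_⟩
    simp only [P, Q, Nat.unpair_pair]
    exact (add_le_add hm hn).trans_eq (ENNReal.add_halves ε)
  choose k hk using fun n : ℕ => H.exists_half_le_graphMeasure hinf hT hT' hν herg
    (fun l : Fin n => P l) (fun l => Q l) (fun l => hVm _) (fun l => hVm _) (fun l => hVf _)
    (fun l => hVf _) (ε := (n : ℝ≥0∞)⁻¹) (ENNReal.inv_ne_zero.2 (ENNReal.natCast_ne_top n))
  obtain ⟨a, φ, hφ, ha⟩ := CompactSpace.tendsto_subseq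
    fun n l => graphMeasure μ T (k n) (P l ×ˢ Q l)
  have ha' := tendsto_pi_nhds.1 ha
  have hahalf : ∀ l, ν (P l ×ˢ Q l) / 2 ≤ a l := by
    intro l
    have hlim := (ha' l).add (ENNReal.tendsto_inv_nat_nhds_zero.comp hφ.tendsto_atTop)
    rw [add_zero] at hlim
    refine ge_of_tendsto hlim ?_
    filter_upwards [eventually_gt_atTop l] with n hn
    exact hk (φ n) ⟨l, hn.trans_le (hφ.id_le n)⟩
  have hΔ := fun n => isSubmarginal_graphMeasure hT hT' (k (φ n))
  have hex : ∀ A B, ∃ c, MeasurableSet A → MeasurableSet B → μ A ≠ ∞ → μ B ≠ ∞ →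
      Tendsto (fun n => graphMeasure μ T (k (φ n)) (A ×ˢ B)) atTop (𝓝 (ν (A ×ˢ B) / 2 + c)) := by
    intro A B
    by_cases hAB : MeasurableSet A ∧ MeasurableSet B ∧ μ A ≠ ∞ ∧ μ B ≠ ∞
    · obtain ⟨hA, hB, hAf, hBf⟩ := hAB
      obtain ⟨c, hc, hac⟩ := IsSubmarginal.exists_tendsto_of_dense hΔ (fun l => hVm _)
        (fun l => hVm _) hdense ha' hA hB hAf hBf
      refine ⟨c - ν (A ×ˢ B) / 2, fun _ _ _ _ => ?_⟩
      rwa [add_tsub_cancel_of_le]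
      refine ENNReal.le_of_forall_pos_le_add fun ε hε _ => ?_
      obtain ⟨l, hl⟩ := hdense A B hA hB hAf hBf (ε / 2) (ENNReal.half_pos (by positivity))
      have h1 : ν (A ×ˢ B) / 2 ≤ ν (P l ×ˢ Q l) / 2 + ε / 2 := by
        have h2 := hsub.prod_le_add_symmDiff hA (hVm l.unpair.1) hB (hVm l.unpair.2)
        rw [add_assoc] at h2
        refine (ENNReal.div_le_div_right (h2.trans (add_le_add le_rfl hl)) 2).trans ?_
        rw [ENNReal.add_div]
        exact add_le_add le_rfl ENNReal.half_le_self
      calc ν (A ×ˢ B) / 2 ≤ a l + ε / 2 := h1.trans (add_le_add (hahalf l) le_rfl)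
        _ ≤ c + ε / 2 + ε / 2 :=
          add_le_add ((hac l).trans (add_le_add le_rfl hl)) le_rfl
        _ = c + ε := by rw [add_assoc, ENNReal.add_halves]
    · exact ⟨0, fun hA hB hAf hBf => absurd ⟨hA, hB, hAf, hBf⟩ hAB⟩
  choose f hf using hex
  have hνf : ∀ A B, MeasurableSet A → μ A ≠ ∞ → ν (A ×ˢ B) / 2 ≠ ∞ := fun A B hA hAf =>
    ENNReal.div_ne_top (ne_top_of_le_ne_top hAf (hsub.le_left hA B)) (by simp)
  suffices hπ : ∃ π : Measure (X × X), ∀ A B, MeasurableSet A → MeasurableSet B → μ A ≠ ∞ →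
      μ B ≠ ∞ → π (A ×ˢ B) = f A B by
    obtain ⟨π, hπ⟩ := hπ
    refine ⟨fun n => k (φ n), π, fun A B hA hB hAf hBf => ?_⟩
    rw [hπ A B hA hB hAf hBf]
    exact hf A B hA hB hAf hBf
  refine exists_measure_prod_of_bimeasure μ f ?_ ?_ ?_ ?_
  · intro A A' B hA hA' hB hAf hA'f hBf hd
    have hUf : μ (A ∪ A') ≠ ∞ := (measure_union_lt_top hAf.lt_top hA'f.lt_top).ne
    have hsplit : ∀ m : Measure (X × X), m ((A ∪ A') ×ˢ B) = m (A ×ˢ B) + m (A' ×ˢ B) := by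
      intro m
      rw [union_prod, measure_union (hd.set_prod_left _ _) (hA'.prod hB)]
    have hlim := tendsto_nhds_unique (hf _ B (hA.union hA') hB hUf hBf)
      (((hf A B hA hB hAf hBf).add (hf A' B hA' hB hA'f hBf)).congr fun n => (hsplit _).symm)
    rw [add_add_add_comm, ← ENNReal.add_div, ← hsplit] at hlim
    exact (ENNReal.add_right_inj (hνf _ _ (hA.union hA') hUf)).1 hlim
  · intro A B B' hA hB hB' hAf hBf hB'f hd
    have hUf : μ (B ∪ B') ≠ ∞ := (measure_union_lt_top hBf.lt_top hB'f.lt_top).ne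
    have hsplit : ∀ m : Measure (X × X), m (A ×ˢ (B ∪ B')) = m (A ×ˢ B) + m (A ×ˢ B') := by
      intro m
      rw [prod_union, measure_union (hd.set_prod_right _ _) (hA.prod hB')]
    have hlim := tendsto_nhds_unique (hf A _ hA (hB.union hB') hAf hUf)
      (((hf A B hA hB hAf hBf).add (hf A B' hA hB' hAf hB'f)).congr fun n => (hsplit _).symm)
    rw [add_add_add_comm, ← ENNReal.add_div, ← hsplit] at hlim
    exact (ENNReal.add_right_inj (hνf _ _ hA hAf)).1 hlim
  · intro A B hA hB hAf hBf
    exact le_add_self.trans (le_of_tendsto' (hf A B hA hB hAf hBf) fun n => (hΔ n).le_left hA B)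
  · intro A B hA hB hAf hBf
    exact le_add_self.trans (le_of_tendsto' (hf A B hA hB hAf hBf) fun n => (hΔ n).le_right A hB)

end Subsequence

/-- **Theorem 1.** If `ν` is an ergodic self-joining of an infinite rank-one
transformation `T`, then for some sequence `k(j)` and some measure `ν'` one has
`Δ^{k(j)} → (1/2)ν + ν'` on rectangles of finite-measure sets, where
`Δ^k(A×B) = μ(A ∩ T^{-k}B)`. -/
theorem ergodic_selfJoining_half_limit_of_rankOne
    {X : Type*} [MeasurableSpace X] [StandardBorelSpace X]
    (μ : Measure X) [SigmaFinite μ] (hinf : μ Set.univ = ∞)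
    (T : Equiv.Perm X) (hTmeas : Measurable (⇑T)) (hTmeas' : Measurable (⇑T.symm))
    (hT : MeasurePreserving ⇑T μ μ) (hrk : IsRankOne μ T)
    (ν : Measure (X × X)) (hν : IsSelfJoining μ T ν)
    (herg : ∀ C : Set (X × X), MeasurableSet C → Prod.map ⇑T ⇑T ⁻¹' C = C →
      ν C = 0 ∨ ν Cᶜ = 0) :
    ∃ (k : ℕ → ℤ) (ν' : Measure (X × X)),
      ∀ A B : Set X, MeasurableSet A → MeasurableSet B → μ A < ∞ → μ B < ∞ →
        Tendsto (fun j => μ (A ∩ (⇑(T ^ k j)) ⁻¹' B)) atTop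
          (𝓝 (ν (A ×ˢ B) / 2 + ν' (A ×ˢ B))) := by
  obtain ⟨E, h, hE, hd, happ⟩ := hrk
  have H : IsRankOneTower μ T E h := ⟨hE, hd, happ⟩
  obtain ⟨k, ν', hk⟩ := H.exists_half_limit hinf hT hTmeas' hν (hν.ergodic hT herg)
  refine ⟨k, ν', fun A B hA hB hAf hBf => ?_⟩
  exact (hk A B hA hB hAf.ne hBf.ne).congr fun j => graphMeasure_prod hT hTmeas' (k j) hA hB
end

section
/- Let T be an ergodic invertible measure-preserving transformation of a σ-finite Lebesgue space (X,μ). Assume T has minimal self-joinings, i.e. every ergodic self-joining of T equals Δ^n for some n∈ℤ. Then T has trivial centralizer: every invertible measure-preserving transformation S of X commuting with T satisfies Sx = T^n x for μ-almost every x, for some n∈ℤ. -/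
open MeasureTheory Filter Topology Set
open scoped ENNReal

theorem measurable_perm_zpow {X : Type*} [MeasurableSpace X] {T : Equiv.Perm X}
    (hT : Measurable ⇑T) (hT' : Measurable ⇑T.symm) (n : ℤ) : Measurable ⇑(T ^ n) := by
  have hpow : ∀ {R : Equiv.Perm X}, Measurable ⇑R → ∀ k : ℕ, Measurable ⇑(R ^ k) := by
    intro R hR k
    rw [Equiv.Perm.coe_pow]
    exact hR.iterate k
  obtain ⟨k, rfl | rfl⟩ := n.eq_nat_or_neg
  · simpa using hpow hT k
  · rw [zpow_neg, zpow_natCast, ← inv_pow]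
    exact hpow (R := T⁻¹) hT' k

/-- A transformation with minimal self-joinings (every ergodic self-joining is
a graph measure `Δ^n = μ.map (x ↦ (x, T^n x))`) has trivial centralizer: every
invertible measure-preserving `S` commuting with `T` agrees a.e. with some
power `T^n`. -/
theorem trivial_centralizer_of_minimal_selfJoinings
    {X : Type*} [MeasurableSpace X] [StandardBorelSpace X]
    (μ : Measure X) [SigmaFinite μ]
    (T : Equiv.Perm X)
    (hTmeas : Measurable (⇑T)) (hTmeas' : Measurable (⇑T.symm))
    (hT : MeasurePreserving ⇑T μ μ)
    (hTerg : ∀ A : Set X, MeasurableSet A → ⇑T ⁻¹' A = A → μ A = 0 ∨ μ Aᶜ = 0)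
    (hmsj : ∀ ν : Measure (X × X), IsSelfJoining μ T ν →
      (∀ C : Set (X × X), MeasurableSet C → Prod.map ⇑T ⇑T ⁻¹' C = C →
        ν C = 0 ∨ ν Cᶜ = 0) →
      ∃ n : ℤ, ν = Measure.map (fun x => (x, (T ^ n) x)) μ) :
    ∀ S : Equiv.Perm X, Measurable (⇑S) → Measurable (⇑S.symm) →
      MeasurePreserving ⇑S μ μ → (∀ x, S (T x) = T (S x)) →
      ∃ n : ℤ, ∀ᵐ x ∂μ, S x = (T ^ n) x := by
  intro S hS _ hSμ hST
  have hpair : Measurable fun x => (x, S x) := measurable_id.prodMk hS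
  have hTT : Measurable (Prod.map ⇑T ⇑T) := hTmeas.prodMap hTmeas
  have hcomp : Prod.map ⇑T ⇑T ∘ (fun x => (x, S x)) = (fun x => (x, S x)) ∘ ⇑T := by
    funext x
    simp [hST]
  have hjoin : IsSelfJoining μ T (μ.map fun x => (x, S x)) := by
    constructor
    · rw [Measure.map_map hTT hpair, hcomp, ← Measure.map_map hpair hTmeas, hT.map_eq]
    · intro A hA _
      rw [Measure.map_apply hpair (hA.prod MeasurableSet.univ),
        Measure.map_apply hpair (MeasurableSet.univ.prod hA)]
      refine ⟨congrArg μ (by ext x; simp), ?_⟩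
      rw [← hSμ.measure_preimage hA.nullMeasurableSet]
      exact congrArg μ (by ext x; simp)
  obtain ⟨n, hn⟩ := hmsj _ hjoin fun C hC hinv => by
    rw [Measure.map_apply hpair hC, Measure.map_apply hpair hC.compl]
    refine hTerg _ (hpair hC) ?_
    rw [← preimage_comp, ← hcomp, preimage_comp, hinv]
  refine ⟨n, ?_⟩
  have hTn : Measurable ⇑(T ^ n) := measurable_perm_zpow hTmeas hTmeas' n
  have hpairn : Measurable fun x => (x, (T ^ n) x) := measurable_id.prodMk hTn
  have hset : MeasurableSet {p : X × X | p.2 = (T ^ n) p.1} :=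
    measurableSet_eq_fun measurable_snd (hTn.comp measurable_fst)
  have hae : ∀ᵐ p ∂μ.map (fun x => (x, S x)), p.2 = (T ^ n) p.1 := by
    rw [hn, ae_map_iff hpairn.aemeasurable hset]
    exact Eventually.of_forall fun _ => rfl
  exact (ae_map_iff hpair.aemeasurable hset).1 hae
end

section
/- Let T be the rank-one transformation built by cutting-and-stacking with two columns, no spacers over the first column, and s_j(2) spacers over the second column at stage j, where s_j(2)/h_j → ∞. Then the set of nonzero weak limits of powers of T is exactly {2^{-m}T^s : m ≥ 1, s ∈ ℤ}: (i) for every sequence of integers n_k → +∞ such that μ(T^{n_k}A ∩ B) converges for all measurable A,B of finite measure to a limit L(A,B) not identically zero, there exist m ≥ 1 and s ∈ ℤ with L(A,B) = 2^{-m}·μ(T^sA ∩ B) for all such A,B; and (ii) for every m ≥ 1 and s ∈ ℤ there is a sequence n_k → +∞ with μ(T^{n_k}A ∩ B) → 2^{-m}·μ(T^sA ∩ B) for all measurable A,B of finite measure. -/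
open MeasureTheory Filter Topology Set
open scoped ENNReal symmDiff

/-- The two-column rank-one cutting-and-stacking construction: at stage `j`
there is a tower `E_j, TE_j, …, T^{h_j-1}E_j` of pairwise disjoint levels; the
tower is cut in two, with no spacers over the first column and `s j` spacers
over the second, so `E_j = E_{j+1} ⊔ T^{h_j}E_{j+1}`, `μ(E_{j+1}) = μ(E_j)/2`
and `h_{j+1} = 2h_j + s j`; the levels cover `X` up to a null set, every set of
finite measure is approximated by unions of levels, and `μ(X) = ∞`. -/
structure TwoColumnCutStack {X : Type*} [MeasurableSpace X] (μ : Measure X)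
    (T : Equiv.Perm X) (E : ℕ → Set X) (h : ℕ → ℕ) (s : ℕ → ℕ) : Prop where
  measT : Measurable (⇑T)
  measTsymm : Measurable (⇑T.symm)
  mp : MeasurePreserving ⇑T μ μ
  infiniteMeasure : μ Set.univ = ∞
  measE : ∀ j, MeasurableSet (E j)
  hpos : ∀ j, 0 < h j
  disjLevels : ∀ j, ∀ i i' : ℕ, i < h j → i' < h j → i ≠ i' →
    Disjoint ((⇑(T ^ (i : ℤ))) '' E j) ((⇑(T ^ (i' : ℤ))) '' E j)
  cut : ∀ j, E j = E (j + 1) ∪ (⇑(T ^ (h j : ℤ))) '' E (j + 1)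
  cutDisj : ∀ j, Disjoint (E (j + 1)) ((⇑(T ^ (h j : ℤ))) '' E (j + 1))
  half : ∀ j, μ (E (j + 1)) = μ (E j) / 2
  height : ∀ j, h (j + 1) = 2 * h j + s j
  cover : μ ((⋃ j, ⋃ i ∈ Finset.range (h j), (⇑(T ^ (i : ℤ))) '' E j)ᶜ) = 0
  approx : ∀ A : Set X, MeasurableSet A → μ A < ∞ → ∀ ε : ℝ≥0∞, 0 < ε →
    ∀ᶠ j in atTop, ∃ I : Finset ℕ, (∀ i ∈ I, i < h j) ∧
      μ (symmDiff A (⋃ i ∈ I, (⇑(T ^ (i : ℤ))) '' E j)) < ε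
  spacerGrowth : Tendsto (fun j => (s j : ℝ) / (h j : ℝ)) atTop atTop

/-- `SignedSum h j m d` says that `d` is a sum of `m` terms `± h l` with distinct indices
`l ≥ j`. -/
inductive SignedSum (h : ℕ → ℕ) : ℕ → ℕ → ℤ → Prop
  | zero (j : ℕ) : SignedSum h j 0 0
  | skip {j m : ℕ} {d : ℤ} : SignedSum h (j + 1) m d → SignedSum h j m d
  | pos {j m : ℕ} {d : ℤ} : SignedSum h (j + 1) m d → SignedSum h j (m + 1) (d + h j)
  | neg {j m : ℕ} {d : ℤ} : SignedSum h (j + 1) m d → SignedSum h j (m + 1) (d - h j)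

namespace SignedSum

variable {h : ℕ → ℕ}

theorem antitone_index {i j m : ℕ} {d : ℤ} (hij : i ≤ j) (hd : SignedSum h j m d) :
    SignedSum h i m d := by
  induction hij using Nat.decreasingInduction with
  | self => exact hd
  | of_succ k hk ih => exact ih.skip

theorem eq_zero_of_no_terms {j : ℕ} {d : ℤ} (hd : SignedSum h j 0 d) : d = 0 := by
  generalize hm : 0 = m at hd
  induction hd with
  | zero => rfl
  | skip _ ih => exact ih hm
  | pos => omega
  | neg => omega

theorem sum_consecutive (m j : ℕ) :
    SignedSum h j m (∑ l ∈ Finset.range m, (h (j + l) : ℤ)) := by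
  induction m generalizing j with
  | zero => simpa using zero j
  | succ m ih =>
    rw [Finset.sum_range_succ']
    have := (ih (j + 1)).pos
    simpa [add_assoc, add_comm 1] using this

theorem height_le_abs {N : ℕ} (grow : ∀ j, N ≤ j → 3 * h j ≤ h (j + 1)) {j m : ℕ} {d : ℤ}
    (hj : N ≤ j) (hd : SignedSum h j m d) (h0 : d ≠ 0) : (h j : ℤ) ≤ |d| := by
  induction hd with
  | zero => exact absurd rfl h0
  | @skip j m d _ ih =>
    have := ih (by omega) h0
    have := grow j hj
    omega
  | @pos j m d _ ih =>
    have := ih (by omega)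
    have := grow j hj
    by_cases hd0 : d = 0 <;> grind
  | @neg j m d _ ih =>
    have := ih (by omega)
    have := grow j hj
    by_cases hd0 : d = 0 <;> grind

theorem height_le_abs_sub {N : ℕ} (grow : ∀ j, N ≤ j → 3 * h j ≤ h (j + 1)) {j m m' : ℕ}
    {d d' : ℤ} (hj : N ≤ j) (hd : SignedSum h j m d) (hd' : SignedSum h j m' d')
    (hne : d ≠ d') : (h j : ℤ) ≤ |d - d'| := by
  induction hd generalizing m' d' with
  | zero =>
    have := height_le_abs grow hj hd' hne.symm
    rwa [zero_sub, abs_neg]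
  | @skip j m d hd ih =>
    have g := grow j hj
    cases hd' with
    | zero => simpa using height_le_abs grow hj hd.skip hne
    | skip hd' => have := ih (by omega) hd'; grind
    | @pos _ _ e hd' => have := ih (by omega) hd'; by_cases d = e <;> grind
    | @neg _ _ e hd' => have := ih (by omega) hd'; by_cases d = e <;> grind
  | @pos j m d hd ih =>
    have g := grow j hj
    cases hd' with
    | zero => simpa using height_le_abs grow hj hd.pos hne
    | @skip _ _ e hd' => have := ih (by omega) hd'; by_cases d = d' <;> grind
    | @pos _ _ e hd' => have := ih (by omega) hd'; by_cases d = e <;> grind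
    | @neg _ _ e hd' => have := ih (by omega) hd'; by_cases d = e <;> grind
  | @neg j m d hd ih =>
    have g := grow j hj
    cases hd' with
    | zero => simpa using height_le_abs grow hj hd.neg hne
    | @skip _ _ e hd' => have := ih (by omega) hd'; by_cases d = d' <;> grind
    | @pos _ _ e hd' => have := ih (by omega) hd'; by_cases d = e <;> grind
    | @neg _ _ e hd' => have := ih (by omega) hd'; by_cases d = e <;> grind

end SignedSum

theorem zpow_image_zpow_image {X : Type*} (T : Equiv.Perm X) (a b : ℤ) (S : Set X) :
    ⇑(T ^ a) '' (⇑(T ^ b) '' S) = ⇑(T ^ (a + b)) '' S := by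
  rw [zpow_add, Equiv.Perm.coe_mul, image_comp]

theorem zpow_image_eq_preimage {X : Type*} (T : Equiv.Perm X) (d : ℤ) (S : Set X) :
    ⇑(T ^ d) '' S = ⇑(T ^ (-d)) ⁻¹' S := by
  rw [Equiv.image_eq_preimage_symm, zpow_neg]
  rfl

/-- A limit of powers of `1/2` that is nonzero is a power of `1/2`, attained eventually. -/
theorem exists_eventually_eq_of_tendsto_geometric {u : ℕ → ℝ} {v e : ℝ} (he : 0 < e)
    (hu : Tendsto u atTop (𝓝 v)) (hv : v ≠ 0)
    (hval : ∀ k, u k ≠ 0 → ∃ m : ℕ, u k = (1 / 2) ^ m * e) :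
    ∃ m : ℕ, ∀ᶠ k in atTop, u k = (1 / 2) ^ m * e := by
  have hnn : ∀ k, 0 ≤ u k := fun k => by
    by_cases h0 : u k = 0
    · exact h0.ge
    · obtain ⟨m, hm⟩ := hval k h0
      rw [hm]; positivity
  have hvpos : 0 < v := lt_of_le_of_ne (ge_of_tendsto' hu hnn) hv.symm
  obtain ⟨M, hM⟩ := exists_pow_lt_of_lt_one (div_pos hvpos he) (by norm_num : (1 / 2 : ℝ) < 1)
  rw [lt_div_iff₀ he] at hM
  set S : Set ℝ := (fun m : ℕ => (1 / 2 : ℝ) ^ m * e) '' Set.Iio M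
  have hfin : S.Finite := (Set.finite_Iio M).image _
  have hmem : ∀ᶠ k in atTop, u k ∈ S := by
    filter_upwards [hu.eventually (lt_mem_nhds hM)] with k hk
    obtain ⟨m, hm⟩ := hval k (ne_of_gt (lt_trans (by positivity) hk))
    refine ⟨m, ?_, hm.symm⟩
    rw [hm] at hk
    have := lt_of_mul_lt_mul_right hk he.le
    exact (pow_lt_pow_iff_right_of_lt_one₀ (by norm_num) (by norm_num)).1 this
  obtain ⟨m, -, hm⟩ := hfin.isClosed.mem_of_tendsto hu hmem
  refine ⟨m, ?_⟩
  have hopen : (S \ {v})ᶜ ∈ 𝓝 v :=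
    (hfin.subset sdiff_subset).isClosed.isOpen_compl.mem_nhds (by simp)
  filter_upwards [hmem, hu.eventually hopen] with k hk hk'
  have : u k = v := by
    by_contra hne
    exact hk' ⟨hk, hne⟩
  rw [this, ← hm]

namespace TwoColumnCutStack

variable {X : Type*} [MeasurableSpace X] {μ : Measure X} {T : Equiv.Perm X} {E : ℕ → Set X}
  {h s : ℕ → ℕ}

theorem measurePreserving_zpow (hT : TwoColumnCutStack μ T E h s) (d : ℤ) :
    MeasurePreserving ⇑(T ^ d) μ μ := by
  have hsymm : MeasurePreserving ⇑T.symm μ μ :=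
    MeasurePreserving.symm (⟨T, hT.measT, hT.measTsymm⟩ : X ≃ᵐ X) hT.mp
  obtain ⟨n, rfl | rfl⟩ := d.eq_nat_or_neg
  · rw [zpow_natCast, ← Equiv.Perm.iterate_eq_pow]
    exact hT.mp.iterate n
  · rw [zpow_neg, zpow_natCast, ← inv_pow, ← Equiv.Perm.iterate_eq_pow]
    exact hsymm.iterate n

theorem measurableSet_image (hT : TwoColumnCutStack μ T E h s) (d : ℤ) {S : Set X}
    (hS : MeasurableSet S) : MeasurableSet (⇑(T ^ d) '' S) := by
  rw [zpow_image_eq_preimage]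
  exact (hT.measurePreserving_zpow (-d)).measurable hS

theorem measure_image (hT : TwoColumnCutStack μ T E h s) (d : ℤ) {S : Set X}
    (hS : MeasurableSet S) : μ (⇑(T ^ d) '' S) = μ S := by
  rw [zpow_image_eq_preimage]
  exact (hT.measurePreserving_zpow (-d)).measure_preimage hS.nullMeasurableSet

theorem measureReal_image (hT : TwoColumnCutStack μ T E h s) (d : ℤ) {S : Set X}
    (hS : MeasurableSet S) : μ.real (⇑(T ^ d) '' S) = μ.real S := by
  rw [measureReal_def, measureReal_def, hT.measure_image d hS]

theorem measure_base (hT : TwoColumnCutStack μ T E h s) (j : ℕ) :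
    μ (E j) = μ (E 0) / 2 ^ j := by
  induction j with
  | zero => simp
  | succ j ih =>
    rw [hT.half, ih, ENNReal.div_eq_inv_mul, ENNReal.div_eq_inv_mul, ENNReal.div_eq_inv_mul,
      ← mul_assoc, pow_succ, ENNReal.mul_inv (by simp) (by simp), mul_comm (2⁻¹ : ℝ≥0∞)]

theorem measure_base_ne_top [SigmaFinite μ] (hT : TwoColumnCutStack μ T E h s) (j : ℕ) :
    μ (E j) ≠ ∞ := by
  intro htop
  have h0 : μ (E 0) = ∞ := by
    by_contra hne
    rw [hT.measure_base] at htop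
    exact ENNReal.div_ne_top hne (by simp) htop
  have hall : ∀ i, μ (E i) = ∞ := fun i => by
    rw [hT.measure_base, h0]
    exact ENNReal.top_div_of_ne_top (by simp)
  have hnull : ∀ A : Set X, MeasurableSet A → μ A < ∞ → μ A = 0 := by
    intro A hA hAfin
    by_contra hne
    have hlt : 0 < min (μ A) 1 := lt_min (pos_iff_ne_zero.2 hne) one_pos
    obtain ⟨i, I, -, hI⟩ := (hT.approx A hA hAfin _ hlt).exists
    obtain rfl | ⟨a, ha⟩ := I.eq_empty_or_nonempty
    · rw [show (⋃ a ∈ (∅ : Finset ℕ), ⇑(T ^ (a : ℤ)) '' E i) = ∅ by simp] at hI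
      have : symmDiff A (∅ : Set X) = A := symmDiff_bot A
      rw [this] at hI
      exact absurd hI (not_lt.2 (min_le_left _ _))
    · set U := ⋃ a ∈ I, ⇑(T ^ (a : ℤ)) '' E i
      have hUtop : μ U = ∞ := by
        rw [eq_top_iff, ← hall i, ← hT.measure_image a (hT.measE i)]
        exact measure_mono (subset_biUnion_of_mem (u := fun a : ℕ => ⇑(T ^ (a : ℤ)) '' E i) ha)
      have hsub : U ⊆ A ∪ symmDiff A U := fun x hx => by
        by_cases hxA : x ∈ A
        · exact Or.inl hxA
        · exact Or.inr (Or.inr ⟨hx, hxA⟩)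
      have := (measure_mono hsub).trans (measure_union_le (μ := μ) _ _)
      rw [hUtop, top_le_iff] at this
      exact ENNReal.add_ne_top.2 ⟨hAfin.ne, (hI.trans_le ((min_le_right _ _).trans
        ENNReal.one_lt_top.le)).ne⟩ this
  have : μ univ = 0 := by
    rw [← iUnion_spanningSets μ]
    exact measure_iUnion_null fun i =>
      hnull _ (measurableSet_spanningSets μ i) (measure_spanningSets_lt_top μ i)
  simp [hT.infiniteMeasure] at this

theorem measureReal_base_pos [SigmaFinite μ] (hT : TwoColumnCutStack μ T E h s) (j : ℕ) :
    0 < μ.real (E j) := by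
  refine ENNReal.toReal_pos (fun hj => ?_) (hT.measure_base_ne_top j)
  have h0 : μ (E 0) = 0 := by
    rw [hT.measure_base, ENNReal.div_eq_zero_iff] at hj
    exact hj.resolve_right (by simp)
  have hunion : μ (⋃ j, ⋃ i ∈ Finset.range (h j), (⇑(T ^ (i : ℤ))) '' E j) = 0 := by
    refine measure_iUnion_null fun j => (measure_biUnion_null_iff (Finset.countable_toSet _)).2 ?_
    intro i _
    rw [hT.measure_image _ (hT.measE j), hT.measure_base, h0, ENNReal.zero_div]
  have := measure_union_null hunion hT.cover
  rw [union_compl_self, hT.infiniteMeasure] at this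
  exact ENNReal.top_ne_zero this

theorem exists_growth (hT : TwoColumnCutStack μ T E h s) :
    ∃ N, ∀ j, N ≤ j → 3 * h j ≤ h (j + 1) := by
  obtain ⟨N, hN⟩ := eventually_atTop.1 (hT.spacerGrowth.eventually_ge_atTop 1)
  refine ⟨N, fun j hj => ?_⟩
  have hp : (0 : ℝ) < h j := by exact_mod_cast hT.hpos j
  have := (one_le_div hp).1 (hN j hj)
  have hle : h j ≤ s j := by exact_mod_cast this
  rw [hT.height]
  omega

theorem le_height (hT : TwoColumnCutStack μ T E h s) (j : ℕ) : j ≤ h j := by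
  induction j with
  | zero => exact Nat.zero_le _
  | succ j ih =>
    have := hT.hpos j
    rw [hT.height]
    omega

theorem measureReal_image_inter_image (hT : TwoColumnCutStack μ T E h s) (j : ℕ) (a b : ℤ) :
    μ.real (⇑(T ^ a) '' E j ∩ ⇑(T ^ b) '' E j) = μ.real (⇑(T ^ (a - b)) '' E j ∩ E j) := by
  rw [← hT.measureReal_image b ((hT.measurableSet_image _ (hT.measE j)).inter (hT.measE j)),
    image_inter (T ^ b).injective, zpow_image_zpow_image, add_sub_cancel]

theorem correlation_eq_zero (hT : TwoColumnCutStack μ T E h s) {j : ℕ} {d : ℤ} (hd : d ≠ 0)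
    (hlt : |d| < h j) : μ.real (⇑(T ^ d) '' E j ∩ E j) = 0 := by
  have key : ∀ n : ℕ, n ≠ 0 → n < h j → Disjoint (⇑(T ^ (n : ℤ)) '' E j) (E j) :=
    fun n hn hnj => by simpa using hT.disjLevels j n 0 hnj (hT.hpos j) hn
  obtain ⟨n, rfl | rfl⟩ := d.eq_nat_or_neg
  · rw [(key n (by simpa using hd) (by simpa using hlt)).inter_eq, measureReal_empty]
  · have := hT.measureReal_image_inter_image j 0 n
    rw [zero_sub] at this
    rw [← this, inter_comm]
    have hdis := key n (by simpa using hd) (by simpa using hlt)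
    rw [zpow_zero, Equiv.Perm.coe_one, image_id, hdis.inter_eq, measureReal_empty]

theorem correlation_succ [SigmaFinite μ] (hT : TwoColumnCutStack μ T E h s) (j : ℕ) (d : ℤ) :
    μ.real (⇑(T ^ d) '' E j ∩ E j) =
      2 * μ.real (⇑(T ^ d) '' E (j + 1) ∩ E (j + 1))
        + μ.real (⇑(T ^ (d + h j)) '' E (j + 1) ∩ E (j + 1))
        + μ.real (⇑(T ^ (d - h j)) '' E (j + 1) ∩ E (j + 1)) := by
  set F := E (j + 1)
  have mF : MeasurableSet F := hT.measE _
  have fF : μ F ≠ ∞ := hT.measure_base_ne_top _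
  have mI : ∀ a : ℤ, MeasurableSet (⇑(T ^ a) '' F) := fun a => hT.measurableSet_image a mF
  have fI : ∀ a : ℤ, μ (⇑(T ^ a) '' F) ≠ ∞ := fun a => by rwa [hT.measure_image a mF]
  have hdis : Disjoint F (⇑(T ^ (h j : ℤ)) '' F) := hT.cutDisj j
  have hdis' : Disjoint (⇑(T ^ d) '' F) (⇑(T ^ (d + h j)) '' F) := by
    rw [← zpow_image_zpow_image]
    exact (disjoint_image_iff (T ^ d).injective).2 hdis
  rw [hT.cut j, image_union, zpow_image_zpow_image, union_inter_distrib_right,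
    measureReal_union (hdis'.mono inter_subset_left inter_subset_left)
      ((mI _).inter (mF.union (mI _))) (measure_ne_top_of_subset inter_subset_left (fI _))
      (measure_ne_top_of_subset inter_subset_left (fI _)),
    inter_union_distrib_left, inter_union_distrib_left,
    measureReal_union (hdis.mono inter_subset_right inter_subset_right)
      ((mI _).inter (mI _)) (measure_ne_top_of_subset inter_subset_left (fI _))
      (measure_ne_top_of_subset inter_subset_left (fI _)),
    measureReal_union (hdis.mono inter_subset_right inter_subset_right)
      ((mI _).inter (mI _)) (measure_ne_top_of_subset inter_subset_left (fI _))
      (measure_ne_top_of_subset inter_subset_left (fI _)),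
    hT.measureReal_image_inter_image, hT.measureReal_image_inter_image, add_sub_cancel_right]
  ring

theorem measureReal_base_succ (hT : TwoColumnCutStack μ T E h s) (j : ℕ) :
    μ.real (E (j + 1)) = μ.real (E j) / 2 := by
  simp [measureReal_def, hT.half, ENNReal.toReal_div]

theorem exists_signedSum_of_correlation_ne_zero [SigmaFinite μ]
    (hT : TwoColumnCutStack μ T E h s) {N : ℕ} (grow : ∀ j, N ≤ j → 3 * h j ≤ h (j + 1))
    {j : ℕ} (hj : N ≤ j) {d : ℤ} (hd : μ.real (⇑(T ^ d) '' E j ∩ E j) ≠ 0) :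
    ∃ m, SignedSum h j m d := by
  have key : ∀ n j : ℕ, N ≤ j → ∀ d : ℤ, 2 * |d| < h (j + n) + h j →
      μ.real (⇑(T ^ d) '' E j ∩ E j) ≠ 0 → ∃ m, SignedSum h j m d := by
    intro n
    induction n with
    | zero =>
      intro j _ d hlt hd
      by_cases hd0 : d = 0
      · exact ⟨0, hd0 ▸ .zero j⟩
      · exact absurd (hT.correlation_eq_zero hd0 (by rw [add_zero] at hlt; omega)) hd
    | succ n ih =>
      intro j hj d hlt hd
      have g := grow j hj
      rw [show j + (n + 1) = j + 1 + n by omega] at hlt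
      have habs := abs_le.1 (le_refl |d|)
      have step : ∀ e : ℤ, |e - d| ≤ h j → μ.real (⇑(T ^ e) '' E (j + 1) ∩ E (j + 1)) ≠ 0 →
          ∃ m, SignedSum h (j + 1) m e := fun e he => ih (j + 1) (by omega) e (by grind)
      rw [hT.correlation_succ] at hd
      by_cases h1 : μ.real (⇑(T ^ d) '' E (j + 1) ∩ E (j + 1)) = 0
      · by_cases h2 : μ.real (⇑(T ^ (d + h j)) '' E (j + 1) ∩ E (j + 1)) = 0
        · obtain ⟨m, hm⟩ := step (d - h j) (by simp) (by simpa [h1, h2] using hd)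
          exact ⟨m + 1, by simpa using hm.pos⟩
        · obtain ⟨m, hm⟩ := step (d + h j) (by simp) h2
          exact ⟨m + 1, by simpa using hm.neg⟩
      · obtain ⟨m, hm⟩ := step d (by simp) h1
        exact ⟨m, hm.skip⟩
  refine key (2 * d.natAbs) j hj d ?_ hd
  have := hT.le_height (j + 2 * d.natAbs)
  have := hT.hpos j
  rw [Int.abs_eq_natAbs]
  omega

theorem correlation_of_near_signedSum [SigmaFinite μ]
    (hT : TwoColumnCutStack μ T E h s) {N : ℕ} (grow : ∀ j, N ≤ j → 3 * h j ≤ h (j + 1))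
    {j m : ℕ} (hj : N ≤ j) {d e : ℤ} (hd : SignedSum h j m d) (hne : e ≠ d)
    (hlt : |e - d| < h j) : μ.real (⇑(T ^ e) '' E j ∩ E j) = 0 := by
  by_contra h0
  obtain ⟨m', hm'⟩ := hT.exists_signedSum_of_correlation_ne_zero grow hj h0
  exact absurd (hm'.height_le_abs_sub grow hj hd hne) (not_le.2 hlt)

theorem correlation_of_signedSum [SigmaFinite μ]
    (hT : TwoColumnCutStack μ T E h s) {N : ℕ} (grow : ∀ j, N ≤ j → 3 * h j ≤ h (j + 1))
    {j m : ℕ} (hj : N ≤ j) {d : ℤ} (hd : SignedSum h j m d) :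
    μ.real (⇑(T ^ d) '' E j ∩ E j) = (1 / 2) ^ m * μ.real (E j) := by
  induction hd with
  | zero => simp
  | @skip j m d hd ih =>
    have g := grow j hj
    have hp := hT.hpos j
    have near := fun e => hT.correlation_of_near_signedSum grow (by omega) hd (e := e)
    rw [hT.correlation_succ, ih (by omega), near (d + h j) (by omega) (by grind),
      near (d - h j) (by omega) (by grind), hT.measureReal_base_succ]
    ring
  | @pos j m d hd ih =>
    have g := grow j hj
    have hp := hT.hpos j
    have near := fun e => hT.correlation_of_near_signedSum grow (by omega) hd (e := e)
    rw [hT.correlation_succ, add_sub_cancel_right, ih (by omega),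
      near (d + h j) (by omega) (by grind),
      near (d + h j + h j) (by omega) (by grind), hT.measureReal_base_succ]
    ring
  | @neg j m d hd ih =>
    have g := grow j hj
    have hp := hT.hpos j
    have near := fun e => hT.correlation_of_near_signedSum grow (by omega) hd (e := e)
    rw [hT.correlation_succ, sub_add_cancel, ih (by omega),
      near (d - h j) (by omega) (by grind),
      near (d - h j - h j) (by omega) (by grind), hT.measureReal_base_succ]
    ring

theorem signedSum_terms_unique [SigmaFinite μ]
    (hT : TwoColumnCutStack μ T E h s) {N : ℕ} (grow : ∀ j, N ≤ j → 3 * h j ≤ h (j + 1))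
    {j m m' : ℕ} (hj : N ≤ j) {d : ℤ} (hd : SignedSum h j m d) (hd' : SignedSum h j m' d) :
    m = m' := by
  have heq := (hT.correlation_of_signedSum grow hj hd).symm.trans
    (hT.correlation_of_signedSum grow hj hd')
  have := mul_right_cancel₀ (hT.measureReal_base_pos j).ne' heq
  exact pow_right_injective₀ (by norm_num : (0 : ℝ) < 1 / 2) (by norm_num) this

theorem measureReal_image_levels_inter_levels [SigmaFinite μ]
    (hT : TwoColumnCutStack μ T E h s) {j : ℕ} {I K : Finset ℕ} (hI : ∀ i ∈ I, i < h j)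
    (hK : ∀ i ∈ K, i < h j) (r : ℤ) :
    μ.real (⇑(T ^ r) '' (⋃ i ∈ I, ⇑(T ^ (i : ℤ)) '' E j) ∩ ⋃ i ∈ K, ⇑(T ^ (i : ℤ)) '' E j) =
      ∑ p ∈ I ×ˢ K, μ.real (⇑(T ^ (r + p.1 - p.2)) '' E j ∩ E j) := by
  have hset : ⇑(T ^ r) '' (⋃ i ∈ I, ⇑(T ^ (i : ℤ)) '' E j) ∩ (⋃ i ∈ K, ⇑(T ^ (i : ℤ)) '' E j) =
      ⋃ p ∈ I ×ˢ K, ⇑(T ^ (r + p.1)) '' E j ∩ ⇑(T ^ (p.2 : ℤ)) '' E j := by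
    simp only [image_iUnion₂, zpow_image_zpow_image]
    ext x
    simp only [mem_inter_iff, mem_iUnion, Finset.mem_product, exists_prop, Prod.exists]
    grind
  have fI : ∀ a : ℤ, μ (⇑(T ^ a) '' E j) ≠ ∞ := fun a => by
    rw [hT.measure_image a (hT.measE j)]; exact hT.measure_base_ne_top j
  rw [hset, measureReal_biUnion_finset ?_ ?_
    fun p _ => measure_ne_top_of_subset inter_subset_left (fI _)]
  · exact Finset.sum_congr rfl fun p _ => hT.measureReal_image_inter_image j _ _
  · rintro ⟨a, b⟩ hab ⟨a', b'⟩ hab' hne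
    simp only [Finset.coe_product, mem_prod, Finset.mem_coe] at hab hab'
    by_cases ha : a = a'
    · have hb : b ≠ b' := fun hb => hne (by rw [ha, hb])
      exact (hT.disjLevels j b b' (hK _ hab.2) (hK _ hab'.2) hb).mono
        inter_subset_right inter_subset_right
    · have := (disjoint_image_iff (T ^ r).injective).2
        (hT.disjLevels j a a' (hI _ hab.1) (hI _ hab'.1) ha)
      rw [zpow_image_zpow_image, zpow_image_zpow_image] at this
      exact this.mono inter_subset_left inter_subset_left
  · exact fun p _ => (hT.measurableSet_image _ (hT.measE j)).inter
      (hT.measurableSet_image _ (hT.measE j))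

theorem measureReal_image_levels_of_signedSum [SigmaFinite μ]
    (hT : TwoColumnCutStack μ T E h s) {N : ℕ} (grow : ∀ j, N ≤ j → 3 * h j ≤ h (j + 1))
    {j m : ℕ} (hj : N ≤ j) {I K : Finset ℕ} (hI : ∀ i ∈ I, i < h j) (hK : ∀ i ∈ K, i < h j)
    {r : ℤ} (hr : SignedSum h j m r) :
    μ.real (⇑(T ^ r) '' (⋃ i ∈ I, ⇑(T ^ (i : ℤ)) '' E j) ∩ ⋃ i ∈ K, ⇑(T ^ (i : ℤ)) '' E j) =
      (1 / 2) ^ m *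
        μ.real ((⋃ i ∈ I, ⇑(T ^ (i : ℤ)) '' E j) ∩ ⋃ i ∈ K, ⇑(T ^ (i : ℤ)) '' E j) := by
  have h0 := hT.measureReal_image_levels_inter_levels hI hK 0
  rw [zpow_zero, Equiv.Perm.coe_one, image_id] at h0
  rw [h0, hT.measureReal_image_levels_inter_levels hI hK, Finset.mul_sum]
  refine Finset.sum_congr rfl fun p hp => ?_
  obtain ⟨a, b⟩ := p
  rw [Finset.mem_product] at hp
  have ha := hI _ hp.1
  have hb := hK _ hp.2
  dsimp only at ha hb ⊢
  by_cases hab : a = b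
  · subst hab
    simpa using hT.correlation_of_signedSum grow hj hr
  · rw [hT.correlation_eq_zero (d := 0 + a - b) (by omega) (by grind), mul_zero]
    exact hT.correlation_of_near_signedSum grow hj hr (by omega) (by grind)

theorem measureReal_image_inter_le (hT : TwoColumnCutStack μ T E h s) (n : ℤ)
    {A A' B B' : Set X} (mA : MeasurableSet A) (mA' : MeasurableSet A')
    (fA : μ A ≠ ∞) (fA' : μ A' ≠ ∞) (fB : μ B ≠ ∞) (fB' : μ B' ≠ ∞) :
    μ.real (⇑(T ^ n) '' A ∩ B) ≤
      μ.real (⇑(T ^ n) '' A' ∩ B') + (μ.real (symmDiff A A') + μ.real (symmDiff B B')) := by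
  have fs : ∀ {C D : Set X}, μ C ≠ ∞ → μ D ≠ ∞ → μ (symmDiff C D) ≠ ∞ := fun hC hD =>
    measure_ne_top_of_subset (symmDiff_le_sup (α := Set X)) (measure_union_ne_top hC hD)
  have mS : MeasurableSet (symmDiff A A') := mA.symmDiff mA'
  have hsub : ⇑(T ^ n) '' A ∩ B ⊆
      (⇑(T ^ n) '' A' ∩ B') ∪ (⇑(T ^ n) '' symmDiff A A' ∪ symmDiff B B') := by
    rintro _ ⟨⟨x, hx, rfl⟩, hB⟩
    by_cases hxA : x ∈ A'
    · by_cases hxB : (T ^ n) x ∈ B'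
      · exact Or.inl ⟨⟨x, hxA, rfl⟩, hxB⟩
      · exact Or.inr (Or.inr (Or.inl ⟨hB, hxB⟩))
    · exact Or.inr (Or.inl ⟨x, Or.inl ⟨hx, hxA⟩, rfl⟩)
  have f1 : μ (⇑(T ^ n) '' A' ∩ B') ≠ ∞ := measure_ne_top_of_subset inter_subset_right fB'
  have f2 : μ (⇑(T ^ n) '' symmDiff A A') ≠ ∞ := by
    rw [hT.measure_image n mS]; exact fs fA fA'
  have f3 := fs fB fB'
  calc _ ≤ _ := measureReal_mono hsub (measure_union_ne_top f1 (measure_union_ne_top f2 f3))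
    _ ≤ _ := measureReal_union_le _ _
    _ ≤ _ := add_le_add_right (measureReal_union_le _ _) _
    _ = _ := by rw [hT.measureReal_image n mS]

theorem exists_levels_approx [SigmaFinite μ] (hT : TwoColumnCutStack μ T E h s) (N : ℕ)
    {A B : Set X} (mA : MeasurableSet A) (mB : MeasurableSet B) (fA : μ A < ∞) (fB : μ B < ∞)
    {ε : ℝ} (hε : 0 < ε) :
    ∃ j, N ≤ j ∧ ∃ I K : Finset ℕ, (∀ i ∈ I, i < h j) ∧ (∀ i ∈ K, i < h j) ∧
      ∀ n : ℤ, |μ.real (⇑(T ^ n) '' A ∩ B) - μ.real (⇑(T ^ n) ''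
        (⋃ i ∈ I, ⇑(T ^ (i : ℤ)) '' E j) ∩ ⋃ i ∈ K, ⇑(T ^ (i : ℤ)) '' E j)| ≤ ε := by
  have hε' : 0 < ENNReal.ofReal (ε / 2) := ENNReal.ofReal_pos.2 (by positivity)
  obtain ⟨j, ⟨⟨I, hI, hAI⟩, K, hK, hBK⟩, hj⟩ :=
    (((hT.approx A mA fA _ hε').and (hT.approx B mB fB _ hε')).and
      (eventually_ge_atTop N)).exists
  refine ⟨j, hj, I, K, hI, hK, fun n => ?_⟩
  have mL : ∀ I : Finset ℕ, MeasurableSet (⋃ i ∈ I, ⇑(T ^ (i : ℤ)) '' E j) := fun I =>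
    I.measurableSet_biUnion fun i _ => hT.measurableSet_image _ (hT.measE j)
  have fL : ∀ I : Finset ℕ, μ (⋃ i ∈ I, ⇑(T ^ (i : ℤ)) '' E j) ≠ ∞ := fun I =>
    (measure_biUnion_lt_top I.finite_toSet fun i _ => by
      rw [hT.measure_image _ (hT.measE j)]
      exact (hT.measure_base_ne_top j).lt_top).ne
  have hreal : ∀ {S : Set X}, μ S < ENNReal.ofReal (ε / 2) → μ.real S ≤ ε / 2 := fun hS =>
    ENNReal.toReal_le_of_le_ofReal (by positivity) hS.le
  have hA := hreal hAI
  have hB := hreal hBK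
  have h1 := hT.measureReal_image_inter_le n mA (mL I) fA.ne (fL I) fB.ne (fL K)
  have h2 := hT.measureReal_image_inter_le n (mL I) mA (fL I) fA.ne (fL K) fB.ne
  rw [symmDiff_comm _ A, symmDiff_comm _ B] at h2
  rw [abs_le]
  constructor <;> linarith

/-- If `r k` is eventually a signed sum of `m` heights of arbitrarily high stage, then
`T ^ r k` converges weakly to `2⁻ᵐ`. -/
theorem tendsto_of_eventually_signedSum [SigmaFinite μ] (hT : TwoColumnCutStack μ T E h s)
    {N m : ℕ} (grow : ∀ j, N ≤ j → 3 * h j ≤ h (j + 1)) {r : ℕ → ℤ}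
    (hr : ∀ j, N ≤ j → ∀ᶠ k in atTop, SignedSum h j m (r k))
    {A B : Set X} (mA : MeasurableSet A) (mB : MeasurableSet B) (fA : μ A < ∞) (fB : μ B < ∞) :
    Tendsto (fun k => μ (⇑(T ^ r k) '' A ∩ B)) atTop (𝓝 ((2 : ℝ≥0∞)⁻¹ ^ m * μ (A ∩ B))) := by
  have fin : ∀ C : Set X, μ (C ∩ B) ≠ ∞ := fun C =>
    measure_ne_top_of_subset inter_subset_right fB.ne
  rw [← ENNReal.tendsto_toReal_iff (fun k => fin _)
    (ENNReal.mul_ne_top (by simp) (fin A)), ENNReal.toReal_mul, ENNReal.toReal_pow,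
    ENNReal.toReal_inv, ENNReal.toReal_ofNat, inv_eq_one_div, Metric.tendsto_atTop']
  intro ε hε
  obtain ⟨j, hj, I, K, hI, hK, happ⟩ := hT.exists_levels_approx N mA mB fA fB
    (show 0 < ε / 3 by positivity)
  obtain ⟨k₀, hk₀⟩ := eventually_atTop.1 (hr j hj)
  refine ⟨k₀, fun k hk => ?_⟩
  have h1 := happ (r k)
  have h2 := happ 0
  rw [hT.measureReal_image_levels_of_signedSum grow hj hI hK (hk₀ k hk.le)] at h1
  rw [zpow_zero, Equiv.Perm.coe_one, image_id, image_id] at h2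
  set U := μ.real ((⋃ i ∈ I, ⇑(T ^ (i : ℤ)) '' E j) ∩ ⋃ i ∈ K, ⇑(T ^ (i : ℤ)) '' E j)
  have h3 : |(1 / 2 : ℝ) ^ m * μ.real (A ∩ B) - (1 / 2) ^ m * U| ≤ ε / 3 := by
    rw [← mul_sub, abs_mul, abs_of_nonneg (by positivity)]
    exact (mul_le_of_le_one_left (abs_nonneg _)
      (pow_le_one₀ (by norm_num) (by norm_num))).trans h2
  rw [Real.dist_eq]
  change |μ.real _ - (1 / 2) ^ m * μ.real _| < ε
  rw [abs_le] at h1 h3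
  rw [abs_lt]
  constructor <;> linarith

theorem exists_eventually_signedSum [SigmaFinite μ] (hT : TwoColumnCutStack μ T E h s)
    {N j : ℕ} (grow : ∀ j, N ≤ j → 3 * h j ≤ h (j + 1)) (hj : N ≤ j) {r : ℕ → ℤ} {v : ℝ}
    (hr : Tendsto (fun k => μ.real (⇑(T ^ r k) '' E j ∩ E j)) atTop (𝓝 v)) (hv : v ≠ 0) :
    ∃ m, ∀ᶠ k in atTop, SignedSum h j m (r k) := by
  have he := hT.measureReal_base_pos j
  have hrep : ∀ k, μ.real (⇑(T ^ r k) '' E j ∩ E j) ≠ 0 → ∃ m, SignedSum h j m (r k) :=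
    fun k => hT.exists_signedSum_of_correlation_ne_zero grow hj
  obtain ⟨m, hm⟩ := exists_eventually_eq_of_tendsto_geometric he hr hv fun k hk =>
    (hrep k hk).imp fun m => hT.correlation_of_signedSum grow hj
  refine ⟨m, hm.mono fun k hk => ?_⟩
  obtain ⟨m', hm'⟩ := hrep k (by rw [hk]; positivity)
  rw [hT.correlation_of_signedSum grow hj hm'] at hk
  have := pow_right_injective₀ (by norm_num : (0 : ℝ) < 1 / 2) (by norm_num)
    (mul_right_cancel₀ he.ne' hk)
  exact this ▸ hm'

/-- If all correlations of `T ^ (n k)` between levels converge, and one of the limits at a high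
stage is nonzero, then `n k - c` is, for some fixed `c`, eventually a signed sum of `m` heights
of arbitrarily high stage. -/
theorem exists_shift_eventually_signedSum [SigmaFinite μ] (hT : TwoColumnCutStack μ T E h s)
    {N : ℕ} (grow : ∀ j, N ≤ j → 3 * h j ≤ h (j + 1)) {n : ℕ → ℤ} {g : ℕ → ℤ → ℝ}
    (hg : ∀ j c, Tendsto (fun k => μ.real (⇑(T ^ (n k - c)) '' E j ∩ E j)) atTop (𝓝 (g j c)))
    (hne : ∃ j, N ≤ j ∧ ∃ c, g j c ≠ 0) :
    ∃ m j, ∃ c : ℤ, N ≤ j ∧ ∀ i, j ≤ i → ∀ᶠ k in atTop, SignedSum h i m (n k - c) := by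
  classical
  have hex : ∃ m j, N ≤ j ∧ ∃ c : ℤ, ∀ᶠ k in atTop, SignedSum h j m (n k - c) := by
    obtain ⟨j, hj, c, hc⟩ := hne
    obtain ⟨m, hm⟩ := hT.exists_eventually_signedSum grow hj (hg j c) hc
    exact ⟨m, j, hj, c, hm⟩
  obtain ⟨j, hj, c, hc⟩ := Nat.find_spec hex
  refine ⟨Nat.find hex, j, c, hj, fun i hi => ?_⟩
  induction i, hi using Nat.le_induction with
  | base => exact hc
  | succ i hi ih =>
    have hiN : N ≤ i := hj.trans hi
    have unique : ∀ m', (∀ᶠ k in atTop, SignedSum h i m' (n k - c)) → m' = Nat.find hex :=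
      fun m' hm' =>
        let ⟨_, h1, h2⟩ := (hm'.and ih).exists
        hT.signedSum_terms_unique grow hiN h1 h2
    have sumEq : g i c = 2 * g (i + 1) c + g (i + 1) (c - h i) + g (i + 1) (c + h i) := by
      refine tendsto_nhds_unique (hg i c) ?_
      have := (((hg (i + 1) c).const_mul 2).add (hg (i + 1) (c - h i))).add
        (hg (i + 1) (c + h i))
      refine this.congr fun k => ?_
      rw [hT.correlation_succ i, ← sub_add, ← sub_sub]
    have hgi : g i c ≠ 0 := by
      have : g i c = (1 / 2) ^ Nat.find hex * μ.real (E i) :=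
        tendsto_nhds_unique (hg i c) (tendsto_const_nhds.congr' (ih.mono fun k hk =>
          (hT.correlation_of_signedSum grow hiN hk).symm))
      rw [this]
      have := hT.measureReal_base_pos i
      positivity
    have hside : ∀ e : ℤ, (∀ m' k, SignedSum h (i + 1) m' (n k - e) →
        SignedSum h i (m' + 1) (n k - c)) → g (i + 1) e = 0 := by
      intro e he
      by_contra h0
      obtain ⟨m', hm'⟩ := hT.exists_eventually_signedSum grow (by omega) (hg (i + 1) e) h0
      have := unique (m' + 1) (hm'.mono fun k => he m' k)
      exact Nat.find_min hex (m := m') (by omega) ⟨i + 1, by omega, e, hm'⟩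
    have hminus := hside (c - h i) fun m' k hk => by
      have := hk.neg
      rwa [show n k - (c - h i) - h i = n k - c by ring] at this
    have hplus := hside (c + h i) fun m' k hk => by
      have := hk.pos
      rwa [show n k - (c + h i) + h i = n k - c by ring] at this
    have hmid : g (i + 1) c ≠ 0 := by
      intro h0
      rw [h0, hminus, hplus] at sumEq
      exact hgi (by simpa using sumEq)
    obtain ⟨m', hm'⟩ := hT.exists_eventually_signedSum grow (by omega) (hg (i + 1) c) hmid
    rwa [← unique m' (hm'.mono fun k hk => hk.skip)]

theorem eq_zero_of_level_limits_eq_zero [SigmaFinite μ] (hT : TwoColumnCutStack μ T E h s)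
    (N : ℕ) {n : ℕ → ℤ}
    (hg : ∀ j, N ≤ j → ∀ c : ℤ,
      Tendsto (fun k => μ.real (⇑(T ^ (n k - c)) '' E j ∩ E j)) atTop (𝓝 0))
    {A B : Set X} (mA : MeasurableSet A) (mB : MeasurableSet B) (fA : μ A < ∞) (fB : μ B < ∞)
    {v : ℝ} (hv : Tendsto (fun k => μ.real (⇑(T ^ n k) '' A ∩ B)) atTop (𝓝 v)) : v = 0 := by
  refine le_antisymm (le_of_forall_pos_le_add fun ε hε => ?_)
    (ge_of_tendsto' hv fun _ => measureReal_nonneg)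
  obtain ⟨j, hj, I, K, hI, hK, happ⟩ := hT.exists_levels_approx N mA mB fA fB hε
  have hlev : Tendsto (fun k => μ.real (⇑(T ^ n k) '' (⋃ i ∈ I, ⇑(T ^ (i : ℤ)) '' E j) ∩
      ⋃ i ∈ K, ⇑(T ^ (i : ℤ)) '' E j)) atTop (𝓝 0) := by
    simp only [hT.measureReal_image_levels_inter_levels hI hK]
    rw [← Finset.sum_const_zero (s := I ×ˢ K)]
    refine tendsto_finsetSum _ fun p _ => (hg j hj (p.2 - p.1)).congr fun k => ?_
    rw [sub_sub_eq_add_sub]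
  exact le_of_tendsto_of_tendsto' hv (hlev.add_const ε) fun k => by
    linarith [(abs_le.1 (happ (n k))).2]

end TwoColumnCutStack

/-- **Assertion 1.** For the two-column construction with `s_j(2)/h_j → ∞` the
set of nonzero weak limits of powers of `T` is exactly
`{2^{-m} T^s : m ≥ 1, s ∈ ℤ}`. -/
theorem weak_closure_of_two_column_construction
    {X : Type*} [MeasurableSpace X] (μ : Measure X) [SigmaFinite μ]
    (T : Equiv.Perm X) (E : ℕ → Set X) (h : ℕ → ℕ) (s : ℕ → ℕ)
    (hT : TwoColumnCutStack μ T E h s) :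
    (∀ n : ℕ → ℤ, Tendsto n atTop atTop →
      ∀ L : Set X → Set X → ℝ≥0∞,
      (∀ A B : Set X, MeasurableSet A → MeasurableSet B → μ A < ∞ → μ B < ∞ →
        Tendsto (fun k => μ ((⇑(T ^ n k)) '' A ∩ B)) atTop (𝓝 (L A B))) →
      (∃ A B : Set X, MeasurableSet A ∧ MeasurableSet B ∧ μ A < ∞ ∧ μ B < ∞ ∧
        L A B ≠ 0) →
      ∃ m : ℕ, 1 ≤ m ∧ ∃ t : ℤ,
        ∀ A B : Set X, MeasurableSet A → MeasurableSet B → μ A < ∞ → μ B < ∞ →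
          L A B = (2 : ℝ≥0∞)⁻¹ ^ m * μ ((⇑(T ^ t)) '' A ∩ B)) ∧
    (∀ m : ℕ, 1 ≤ m → ∀ t : ℤ,
      ∃ n : ℕ → ℤ, Tendsto n atTop atTop ∧
        ∀ A B : Set X, MeasurableSet A → MeasurableSet B → μ A < ∞ → μ B < ∞ →
          Tendsto (fun k => μ ((⇑(T ^ n k)) '' A ∩ B)) atTop
            (𝓝 ((2 : ℝ≥0∞)⁻¹ ^ m * μ ((⇑(T ^ t)) '' A ∩ B)))) := by
  obtain ⟨N, grow⟩ := hT.exists_growth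
  refine ⟨fun n hn L hL hne => ?_, fun m hm t => ?_⟩
  · have hLreal : ∀ A B : Set X, MeasurableSet A → MeasurableSet B → μ A < ∞ → μ B < ∞ →
        Tendsto (fun k => μ.real (⇑(T ^ n k) '' A ∩ B)) atTop (𝓝 (L A B).toReal) ∧
          L A B ≠ ∞ := by
      intro A B mA mB fA fB
      have hle : L A B ≤ μ B :=
        le_of_tendsto' (hL A B mA mB fA fB) fun k => measure_mono inter_subset_right
      have htop := (hle.trans_lt fB).ne
      exact ⟨(ENNReal.tendsto_toReal htop).comp (hL A B mA mB fA fB), htop⟩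
    have hE : ∀ j, μ (E j) < ∞ := fun j => (hT.measure_base_ne_top j).lt_top
    have hg : ∀ j (c : ℤ), Tendsto (fun k => μ.real (⇑(T ^ (n k - c)) '' E j ∩ E j)) atTop
        (𝓝 (L (E j) (⇑(T ^ c) '' E j)).toReal) := by
      intro j c
      refine (hLreal (E j) (⇑(T ^ c) '' E j) (hT.measE j)
        (hT.measurableSet_image c (hT.measE j)) (hE j)
        (by rw [hT.measure_image c (hT.measE j)]; exact hE j)).1.congr fun k => ?_
      rw [hT.measureReal_image_inter_image]
    have hlevel : ∃ j, N ≤ j ∧ ∃ c : ℤ, (L (E j) (⇑(T ^ c) '' E j)).toReal ≠ 0 := by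
      by_contra! hzero
      obtain ⟨A, B, mA, mB, fA, fB, hAB⟩ := hne
      obtain ⟨hlim, htop⟩ := hLreal A B mA mB fA fB
      have := hT.eq_zero_of_level_limits_eq_zero N
        (fun j hj c => hzero j hj c ▸ hg j c) mA mB fA fB hlim
      exact (ENNReal.toReal_ne_zero.2 ⟨hAB, htop⟩) this
    obtain ⟨m, j, c, hj, hsum⟩ := hT.exists_shift_eventually_signedSum grow hg hlevel
    refine ⟨m, Nat.one_le_iff_ne_zero.2 ?_, c, fun A B mA mB fA fB => ?_⟩
    · rintro rfl
      obtain ⟨k, hk, hlt⟩ := ((hsum j le_rfl).and (hn.eventually_gt_atTop c)).exists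
      have := hk.eq_zero_of_no_terms
      omega
    · refine tendsto_nhds_unique (hL A B mA mB fA fB) ?_
      have := hT.tendsto_of_eventually_signedSum (fun i hi => grow i (hj.trans hi)) hsum
        (hT.measurableSet_image c mA) mB (by rwa [hT.measure_image c mA]) fB
      simpa only [zpow_image_zpow_image, sub_add_cancel] using this
  · refine ⟨fun k => ∑ l ∈ Finset.range m, (h (k + l) : ℤ) + t, ?_, fun A B mA mB fA fB => ?_⟩
    · refine tendsto_atTop_add_const_right _ _
        (tendsto_atTop_mono (fun k => ?_) tendsto_natCast_atTop_atTop)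
      have h1 : (h (k + 0) : ℤ) ≤ ∑ l ∈ Finset.range m, (h (k + l) : ℤ) :=
        Finset.single_le_sum (f := fun l => (h (k + l) : ℤ)) (fun l _ => by positivity)
          (Finset.mem_range.2 hm)
      have h2 := hT.le_height k
      rw [add_zero] at h1
      omega
    · have := hT.tendsto_of_eventually_signedSum (m := m) grow
        (r := fun k => ∑ l ∈ Finset.range m, (h (k + l) : ℤ))
        (fun j _ => (eventually_ge_atTop j).mono fun k hk =>
          (SignedSum.sum_consecutive m k).antitone_index hk)
        (hT.measurableSet_image t mA) mB (by rwa [hT.measure_image t mA]) fB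
      simpa only [zpow_image_zpow_image] using this
end
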